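/- arXiv:2402.09673 — 4 statements merged into one kernel-verified Lean document; each statement's English description precedes it below -/
import Mathlib

section
/- Local optimality of the first subspace exclusion code for equivocation (Theorem 4): assume κ ≥ 2 and let U be any (κ−1)-dimensional subspace of W. Then q̌^{[U]} is a local minimizer of the function q ↦ l(q) relative to the constraint set Δ' := {q ∈ Δ | q(0) = 0 and Σ_{v∈W} (q(v) − q̄(v))² = (2^{κ−1} − 1)/(2^{κ−1}(2^κ − 1))} (i.e., IsLocalMinOn l Δ' q̌^{[U]}). -/
attribute [local instance] Classical.propDecidable

noncomputable instance {κ : ℕ} : Fintype (Submodule (ZMod 2) (Fin κ → ZMod 2)) :=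
  haveI : Finite (Submodule (ZMod 2) (Fin κ → ZMod 2)) :=
    Finite.of_injective (fun S => (S : Set (Fin κ → ZMod 2))) SetLike.coe_injective
  Fintype.ofFinite _

/-- `ζ(S,q)`: the sum of `q v` over the vectors `v` lying in the subspace `S`. -/
noncomputable def zeta (κ : ℕ) (S : Submodule (ZMod 2) (Fin κ → ZMod 2))
    (q : (Fin κ → ZMod 2) → ℝ) : ℝ :=
  ∑ v : Fin κ → ZMod 2, if v ∈ S then q v else 0

/-- The feasible simplex `Δ` of code-definition vectors. -/
def simplex (κ : ℕ) : Set ((Fin κ → ZMod 2) → ℝ) :=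
  {q | (∀ v, 0 ≤ q v) ∧ ∑ v, q v = 1}

/-- The expected equivocation loss
`l(q) = n(1−ε) − κ + Σ_{δ=1}^{κ} K_δ Σ_{dim S = κ−δ} ε^{n(1−ζ(S,q))}`,
where `K_δ = ∏_{i=1}^{δ−1} (1 − 2^i)` and the power is the real power. -/
noncomputable def eqLoss (κ n : ℕ) (ε : ℝ) (q : (Fin κ → ZMod 2) → ℝ) : ℝ :=
  (n : ℝ) * (1 - ε) - (κ : ℝ) +
    ∑ δ ∈ Finset.Icc 1 κ,
      (∏ i ∈ Finset.Icc 1 (δ - 1), (1 - (2 : ℝ) ^ i)) *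
        ∑ S ∈ Finset.univ.filter
            (fun S : Submodule (ZMod 2) (Fin κ → ZMod 2) =>
              Module.finrank (ZMod 2) S = κ - δ),
          ε ^ ((n : ℝ) * (1 - zeta κ S q))

/-- The uniform vector fraction code: `q̄(0) = 0`, `q̄(v) = 1/(2^κ − 1)` for `v ≠ 0`. -/
noncomputable def qbar (κ : ℕ) : (Fin κ → ZMod 2) → ℝ :=
  fun v => if v = 0 then 0 else 1 / ((2 : ℝ) ^ κ - 1)

/-- The subspace exclusion code `q̌^{[U]}`: zero on `U`, `1/(2^κ − 2^u)` off `U`,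
where `u = dim U`. -/
noncomputable def qcheck (κ : ℕ) (U : Submodule (ZMod 2) (Fin κ → ZMod 2)) :
    (Fin κ → ZMod 2) → ℝ :=
  fun v => if v ∈ U then 0 else 1 / ((2 : ℝ) ^ κ - (2 : ℝ) ^ (Module.finrank (ZMod 2) U))

/-- A nonzero element of `ZMod 2` is one. -/
lemma zmod_two_eq_one {a : ZMod 2} (h : a ≠ 0) : a = 1 := by
  revert a; decide

lemma exists_functional_eq_one {κ : ℕ} {T : Submodule (ZMod 2) (Fin κ → ZMod 2)}
    {z : Fin κ → ZMod 2} (hz : z ∉ T) :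
    ∃ f : (Fin κ → ZMod 2) →ₗ[ZMod 2] ZMod 2, f z = 1 ∧ ∀ v ∈ T, f v = 0 := by
  obtain ⟨f, hf, hT⟩ := Submodule.exists_le_ker_of_notMem hz
  exact ⟨f, zmod_two_eq_one hf, fun v hv => hT hv⟩

lemma add_self_zmod_two {κ : ℕ} (v : Fin κ → ZMod 2) : v + v = 0 :=
  funext fun i => CharTwo.add_self_eq_zero (v i)

lemma card_filter_mem {κ : ℕ} (S : Submodule (ZMod 2) (Fin κ → ZMod 2)) :
    (Finset.univ.filter (fun v => v ∈ S)).card = 2 ^ Module.finrank (ZMod 2) S := by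
  rw [← Fintype.card_subtype, Module.card_eq_pow_finrank (K := ZMod 2), ZMod.card]

/-- The number of subspaces meeting the kernel of `f` in `R`, not contained in that kernel and
avoiding `z`, where `f z = 1`. -/
lemma card_extensions {κ : ℕ} {f : (Fin κ → ZMod 2) →ₗ[ZMod 2] ZMod 2} {z : Fin κ → ZMod 2}
    (hz : f z = 1) {R : Submodule (ZMod 2) (Fin κ → ZMod 2)} (hR : R ≤ LinearMap.ker f) :
    (Finset.univ.filter (fun S : Submodule (ZMod 2) (Fin κ → ZMod 2) =>
        z ∉ S ∧ ¬ S ≤ LinearMap.ker f ∧ S ⊓ LinearMap.ker f = R)).card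
        * 2 ^ Module.finrank (ZMod 2) R + 2 ^ Module.finrank (ZMod 2) R
      = 2 ^ Module.finrank (ZMod 2) (LinearMap.ker f) := by
  set E := Finset.univ.filter (fun S : Submodule (ZMod 2) (Fin κ → ZMod 2) =>
        z ∉ S ∧ ¬ S ≤ LinearMap.ker f ∧ S ⊓ LinearMap.ker f = R) with hE
  set A := Finset.univ.filter (fun v => v ∈ LinearMap.ker f) with hA
  set B := Finset.univ.filter (fun v => v ∈ R) with hB
  have hBA : B ⊆ A := by
    intro v hv
    simp only [hA, hB, Finset.mem_filter, Finset.mem_univ, true_and] at hv ⊢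
    exact hR hv
  have key : E.card * B.card = (A \ B).card * 1 := by
    refine Finset.card_mul_eq_card_mul (fun S h => z + h ∈ S) ?_ ?_
    · intro S hS
      simp only [hE, Finset.mem_filter, Finset.mem_univ, true_and] at hS
      obtain ⟨hzS, hnot, hSR⟩ := hS
      obtain ⟨s, hs, hfs⟩ := SetLike.not_le_iff_exists.1 hnot
      have hfs : f s = 1 := zmod_two_eq_one hfs
      symm
      refine Finset.card_bij (fun r _ => r + s + z) ?_ ?_ ?_
      · intro r hr
        simp only [hB, Finset.mem_filter, Finset.mem_univ, true_and] at hr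
        have hrS : r ∈ S ⊓ LinearMap.ker f := hSR ▸ hr
        have hsum : z + (r + s + z) = r + s := by
          rw [add_comm z, add_assoc, add_self_zmod_two, add_zero]
        have hmem : z + (r + s + z) ∈ S := by
          rw [hsum]; exact S.add_mem hrS.1 hs
        simp only [Finset.mem_bipartiteAbove, hA, hB, Finset.mem_sdiff, Finset.mem_filter,
          Finset.mem_univ, true_and]
        refine ⟨⟨?_, ?_⟩, hmem⟩
        · have h0 : f r = 0 := hrS.2
          rw [LinearMap.mem_ker, map_add, map_add, h0, hfs, hz]; decide
        · intro h
          have h' : r + s + z ∈ S ⊓ LinearMap.ker f := hSR ▸ h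
          have := S.sub_mem hmem h'.1
          rw [add_sub_cancel_right] at this
          exact hzS this
      · intro a _ b _ hab
        simpa using hab
      · intro h hh
        simp only [Finset.mem_bipartiteAbove, hA, hB, Finset.mem_sdiff, Finset.mem_filter,
          Finset.mem_univ, true_and] at hh
        have h0 : f h = 0 := hh.1.1
        refine ⟨z + h + s, ?_, ?_⟩
        · simp only [hB, Finset.mem_filter, Finset.mem_univ, true_and]
          rw [← hSR]
          refine ⟨S.add_mem hh.2 hs, LinearMap.mem_ker.2 ?_⟩
          rw [map_add, map_add, h0, hfs, hz]; decide
        · calc z + h + s + s + z = (z + z) + (s + s) + h := by abel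
            _ = h := by rw [add_self_zmod_two, add_self_zmod_two, zero_add, zero_add]
    · intro h hh
      simp only [hA, hB, Finset.mem_sdiff, Finset.mem_filter, Finset.mem_univ, true_and] at hh
      have h0 : f h = 0 := hh.1
      have hzh : f (z + h) = 1 := by rw [map_add, hz, h0, add_zero]
      rw [Finset.card_eq_one]
      refine ⟨R ⊔ Submodule.span (ZMod 2) {z + h}, ?_⟩
      have hmemsup : z + h ∈ R ⊔ Submodule.span (ZMod 2) {z + h} :=
        Submodule.mem_sup_right (Submodule.mem_span_singleton_self _)
      have hform : ∀ x ∈ R ⊔ Submodule.span (ZMod 2) {z + h},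
          (f x = 0 → x ∈ R) ∧ (f x = 1 → x + (z + h) ∈ R) := by
        intro x hx
        obtain ⟨r, hr, y, hy, rfl⟩ := Submodule.mem_sup.1 hx
        obtain ⟨c, rfl⟩ := Submodule.mem_span_singleton.1 hy
        have hr0 : f r = 0 := hR hr
        rw [map_add, map_smul, hr0, hzh, zero_add, smul_eq_mul, mul_one]
        refine ⟨fun hc => by simpa [hc] using hr, fun hc => ?_⟩
        rw [hc, one_smul, add_assoc, add_self_zmod_two, add_zero]
        exact hr
      ext S
      simp only [Finset.mem_bipartiteBelow, hE, Finset.mem_filter, Finset.mem_univ, true_and,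
        Finset.mem_singleton]
      constructor
      · rintro ⟨⟨-, -, hSR⟩, hmem⟩
        apply le_antisymm
        · intro s hs
          by_cases hfs : f s = 0
          · exact Submodule.mem_sup_left (hSR ▸ ⟨hs, hfs⟩)
          · have hs1 : f s = 1 := zmod_two_eq_one hfs
            have : s + (z + h) ∈ R := by
              rw [← hSR]
              refine ⟨S.add_mem hs hmem, LinearMap.mem_ker.2 ?_⟩
              rw [map_add, hs1, hzh]; decide
            have h2 := Submodule.add_mem _ (Submodule.mem_sup_left this) hmemsup
            rwa [add_assoc, add_self_zmod_two, add_zero] at h2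
        · refine sup_le ?_ ?_
          · rw [← hSR]; exact inf_le_left
          · rwa [Submodule.span_singleton_le_iff_mem]
      · rintro rfl
        refine ⟨⟨?_, ?_, ?_⟩, hmemsup⟩
        · intro hzmem
          have := (hform z hzmem).2 hz
          rw [← add_assoc, add_self_zmod_two, zero_add] at this
          exact hh.2 this
        · intro hle
          have : f (z + h) = 0 := hle hmemsup
          rw [hzh] at this
          exact one_ne_zero this
        · apply le_antisymm
          · rintro x ⟨hx, hx0⟩
            exact (hform x hx).1 hx0
          · exact le_inf le_sup_left hR
  rw [← card_filter_mem R, ← card_filter_mem (LinearMap.ker f), key, mul_one]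
  exact Finset.card_sdiff_add_card_eq_card hBA

/-- A subspace not contained in the kernel of a functional meets it in codimension one. -/
lemma finrank_inf_ker_add_one {κ : ℕ} {f : (Fin κ → ZMod 2) →ₗ[ZMod 2] ZMod 2}
    {S : Submodule (ZMod 2) (Fin κ → ZMod 2)} (hS : ¬ S ≤ LinearMap.ker f) :
    Module.finrank (ZMod 2) (S ⊓ LinearMap.ker f : Submodule (ZMod 2) (Fin κ → ZMod 2)) + 1
      = Module.finrank (ZMod 2) S := by
  obtain ⟨s, hs, hfs⟩ := SetLike.not_le_iff_exists.1 hS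
  have hfs : f s = 1 := zmod_two_eq_one hfs
  have hsn : s ∉ S ⊓ LinearMap.ker f := fun h => by
    have : f s = 0 := h.2
    rw [hfs] at this
    exact one_ne_zero this
  suffices hsup : S ⊓ LinearMap.ker f ⊔ Submodule.span (ZMod 2) {s} = S by
    rw [← Submodule.finrank_sup_span_singleton hsn, hsup]
  apply le_antisymm
  · exact sup_le inf_le_left ((Submodule.span_singleton_le_iff_mem _ _).2 hs)
  · intro x hx
    have hsm := Submodule.mem_span_singleton_self (R := ZMod 2) s
    by_cases hfx : f x = 0
    · exact Submodule.mem_sup_left ⟨hx, hfx⟩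
    · have hx1 : f x = 1 := zmod_two_eq_one hfx
      have : x + s ∈ S ⊓ LinearMap.ker f := by
        refine ⟨S.add_mem hx hs, LinearMap.mem_ker.2 ?_⟩
        rw [map_add, hx1, hfs]; decide
      have h2 := Submodule.add_mem _ (Submodule.mem_sup_left this) (Submodule.mem_sup_right hsm)
      rwa [add_assoc, add_self_zmod_two, add_zero] at h2

/-- The coefficient of the subspace `S` in the expected equivocation loss. -/
noncomputable def lossCoeff {κ : ℕ} (S : Submodule (ZMod 2) (Fin κ → ZMod 2)) : ℝ :=
  if S = ⊤ then 0 else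
    ∏ i ∈ Finset.Icc 1 (κ - Module.finrank (ZMod 2) S - 1), (1 - (2 : ℝ) ^ i)

/-- Möbius-type inversion: the coefficients of the subspaces that contain `T` and avoid a vector
outside `T` sum to one. -/
lemma sum_lossCoeff_notMem {κ : ℕ} {T : Submodule (ZMod 2) (Fin κ → ZMod 2)}
    {z : Fin κ → ZMod 2} (hz : z ∉ T) :
    ∑ S ∈ Finset.univ.filter (fun S => T ≤ S ∧ z ∉ S), lossCoeff S = 1 := by
  obtain ⟨f, hfz, hfT⟩ := exists_functional_eq_one hz
  have hTf : T ≤ LinearMap.ker f := hfT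
  have hf0 : f ≠ 0 := fun h => by simp [h] at hfz
  have hker : Module.finrank (ZMod 2) (LinearMap.ker f) + 1 = κ := by
    have := Module.Dual.finrank_ker_add_one_of_ne_zero hf0
    simpa using this
  have hzker : ∀ S ≤ LinearMap.ker f, z ∉ S := fun S hS h => by
    have : f z = 0 := hS h
    rw [hfz] at this
    exact one_ne_zero this
  have hcoeff : ∀ S : Submodule (ZMod 2) (Fin κ → ZMod 2), z ∉ S → lossCoeff S =
      ∏ i ∈ Finset.Icc 1 (κ - Module.finrank (ZMod 2) S - 1), (1 - (2 : ℝ) ^ i) :=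
    fun S hS => if_neg fun h => hS (by rw [h]; exact Submodule.mem_top)
  rw [← Finset.sum_filter_add_sum_filter_not _ (fun S => S ≤ LinearMap.ker f),
    Finset.filter_filter, Finset.filter_filter]
  have hmaps : ∀ S ∈ Finset.univ.filter (fun S : Submodule (ZMod 2) (Fin κ → ZMod 2) =>
      (T ≤ S ∧ z ∉ S) ∧ ¬ S ≤ LinearMap.ker f), S ⊓ LinearMap.ker f ∈
      Finset.univ.filter (fun S : Submodule (ZMod 2) (Fin κ → ZMod 2) =>
      (T ≤ S ∧ z ∉ S) ∧ S ≤ LinearMap.ker f) := by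
    intro S hS
    simp only [Finset.mem_filter, Finset.mem_univ, true_and] at hS ⊢
    exact ⟨⟨le_inf hS.1.1 hTf, fun h => hS.1.2 h.1⟩, inf_le_right⟩
  rw [← Finset.sum_fiberwise_of_maps_to hmaps, ← Finset.sum_add_distrib]
  have hmem : LinearMap.ker f ∈ Finset.univ.filter
      (fun S : Submodule (ZMod 2) (Fin κ → ZMod 2) => (T ≤ S ∧ z ∉ S) ∧ S ≤ LinearMap.ker f) := by
    simp only [Finset.mem_filter, Finset.mem_univ, true_and]
    exact ⟨⟨hTf, hzker _ le_rfl⟩, le_rfl⟩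
  refine (Finset.sum_congr rfl fun R hR => ?_).trans
    ((Finset.sum_ite_eq' _ (LinearMap.ker f) fun _ => (1 : ℝ)).trans (if_pos hmem))
  simp only [Finset.mem_filter, Finset.mem_univ, true_and] at hR
  obtain ⟨⟨hTR, hzR⟩, hRf⟩ := hR
  have hset : (Finset.univ.filter (fun S : Submodule (ZMod 2) (Fin κ → ZMod 2) =>
      (T ≤ S ∧ z ∉ S) ∧ ¬ S ≤ LinearMap.ker f)).filter (fun S => S ⊓ LinearMap.ker f = R)
      = Finset.univ.filter (fun S : Submodule (ZMod 2) (Fin κ → ZMod 2) =>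
        z ∉ S ∧ ¬ S ≤ LinearMap.ker f ∧ S ⊓ LinearMap.ker f = R) := by
    ext S
    simp only [Finset.mem_filter, Finset.mem_univ, true_and]
    constructor
    · rintro ⟨⟨⟨-, h1⟩, h2⟩, h3⟩
      exact ⟨h1, h2, h3⟩
    · rintro ⟨h1, h2, h3⟩
      exact ⟨⟨⟨(h3 ▸ hTR).trans inf_le_left, h1⟩, h2⟩, h3⟩
  have hcard := card_extensions hfz hRf
  rw [hset, Finset.sum_congr rfl (g := fun _ =>
    ∏ i ∈ Finset.Icc 1 (κ - Module.finrank (ZMod 2) R - 1 - 1), (1 - (2 : ℝ) ^ i)) ?_,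
    Finset.sum_const, nsmul_eq_mul, hcoeff R hzR]
  · set C := (Finset.univ.filter (fun S : Submodule (ZMod 2) (Fin κ → ZMod 2) =>
        z ∉ S ∧ ¬ S ≤ LinearMap.ker f ∧ S ⊓ LinearMap.ker f = R)).card
    set r := Module.finrank (ZMod 2) R with hr
    have hrle : r ≤ Module.finrank (ZMod 2) (LinearMap.ker f) := Submodule.finrank_mono hRf
    obtain ⟨e, he⟩ := Nat.exists_eq_add_of_le hrle
    have hκ : κ - r - 1 = e := by omega
    have hC : (C : ℝ) = 2 ^ e - 1 := by
      rw [he, pow_add] at hcard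
      have h2 : (0 : ℝ) < 2 ^ r := by positivity
      have h3 : (C : ℝ) * 2 ^ r + 2 ^ r = 2 ^ r * 2 ^ e := by exact_mod_cast hcard
      have h4 : (2 : ℝ) ^ r * (C - (2 ^ e - 1)) = 0 := by linarith
      have := (mul_eq_zero.1 h4).resolve_left h2.ne'
      linarith
    rw [hκ, hC]
    by_cases hRk : R = LinearMap.ker f
    · have he0 : e = 0 := by rw [hr, hRk] at he; omega
      subst he0
      simp [hRk]
    · rw [if_neg hRk]
      have he0 : e ≠ 0 := fun h0 =>
        hRk (Submodule.eq_of_le_of_finrank_eq hRf (by rw [← hr]; omega))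
      obtain ⟨e, rfl⟩ := Nat.exists_eq_add_one_of_ne_zero he0
      rw [Nat.add_sub_cancel, Finset.prod_Icc_succ_top (by omega)]
      ring
  · intro S hS
    simp only [Finset.mem_filter, Finset.mem_univ, true_and] at hS
    have := finrank_inf_ker_add_one hS.2.1
    rw [hS.2.2] at this
    rw [hcoeff S hS.1, ← this, Nat.sub_sub, Nat.sub_sub, Nat.sub_sub]

lemma mem_sup_span_singleton_zmod_two {κ : ℕ} {T : Submodule (ZMod 2) (Fin κ → ZMod 2)}
    {u v : Fin κ → ZMod 2} :
    v ∈ T ⊔ Submodule.span (ZMod 2) {u} ↔ v ∈ T ∨ u + v ∈ T := by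
  have hu := Submodule.mem_span_singleton_self (R := ZMod 2) u
  constructor
  · intro hv
    obtain ⟨t, ht, y, hy, rfl⟩ := Submodule.mem_sup.1 hv
    obtain ⟨c, rfl⟩ := Submodule.mem_span_singleton.1 hy
    by_cases hc : c = 0
    · left; simpa [hc] using ht
    · right
      rw [zmod_two_eq_one hc, one_smul, add_comm t, ← add_assoc, add_self_zmod_two, zero_add]
      exact ht
  · rintro (hv | hv)
    · exact Submodule.mem_sup_left hv
    · have := Submodule.add_mem _ (Submodule.mem_sup_right (S := T) hu)
        (Submodule.mem_sup_left (T := Submodule.span (ZMod 2) {u}) hv)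
      rwa [← add_assoc, add_self_zmod_two, zero_add] at this

lemma sum_lossCoeff_mem_notMem {κ : ℕ} (T : Submodule (ZMod 2) (Fin κ → ZMod 2))
    (u v : Fin κ → ZMod 2) :
    ∑ S ∈ Finset.univ.filter (fun S => T ≤ S ∧ u ∈ S ∧ v ∉ S), lossCoeff S
      = if v ∉ T ∧ u + v ∉ T then 1 else 0 := by
  have hset : Finset.univ.filter (fun S : Submodule (ZMod 2) (Fin κ → ZMod 2) =>
      T ≤ S ∧ u ∈ S ∧ v ∉ S) =
      Finset.univ.filter (fun S => T ⊔ Submodule.span (ZMod 2) {u} ≤ S ∧ v ∉ S) := by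
    ext S
    simp only [Finset.mem_filter, Finset.mem_univ, true_and, sup_le_iff,
      Submodule.span_singleton_le_iff_mem, and_assoc]
  have hiff : (v ∉ T ∧ u + v ∉ T) ↔ v ∉ T ⊔ Submodule.span (ZMod 2) {u} := by
    rw [← not_or, ← mem_sup_span_singleton_zmod_two]
  rw [hset]
  split_ifs with h
  · exact sum_lossCoeff_notMem (hiff.1 h)
  · rw [hiff, not_not] at h
    refine Finset.sum_eq_zero fun S hS => ?_
    simp only [Finset.mem_filter, Finset.mem_univ, true_and] at hS
    exact absurd (hS.1 h) hS.2

/-- The vectors outside `U`. -/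
noncomputable def offVectors {κ : ℕ} (U : Submodule (ZMod 2) (Fin κ → ZMod 2)) :
    Finset (Fin κ → ZMod 2) :=
  Finset.univ.filter (fun v => v ∉ U)

lemma mem_offVectors {κ : ℕ} {U : Submodule (ZMod 2) (Fin κ → ZMod 2)} {v : Fin κ → ZMod 2} :
    v ∈ offVectors U ↔ v ∉ U := by
  simp [offVectors]

/-- The coefficient of `S` times the probability that a random set of vectors outside `U`, from
which each vector is missing independently with probability `x`, lies in `S`. -/
noncomputable def lossWeight {κ : ℕ} (U : Submodule (ZMod 2) (Fin κ → ZMod 2)) (x : ℝ)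
    (S : Submodule (ZMod 2) (Fin κ → ZMod 2)) : ℝ :=
  lossCoeff S * x ^ ((offVectors U).filter (fun v => v ∉ S)).card

/-- The total weight of the subspaces through `v`. -/
noncomputable def weightThrough {κ : ℕ} (U : Submodule (ZMod 2) (Fin κ → ZMod 2)) (x : ℝ)
    (v : Fin κ → ZMod 2) : ℝ :=
  ∑ S, if v ∈ S then lossWeight U x S else 0

/-- The total weight of the subspaces through both `v` and `w`. -/
noncomputable def weightThroughPair {κ : ℕ} (U : Submodule (ZMod 2) (Fin κ → ZMod 2)) (x : ℝ)
    (v w : Fin κ → ZMod 2) : ℝ :=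
  ∑ S, if v ∈ S ∧ w ∈ S then lossWeight U x S else 0

lemma weightThrough_sub_pair {κ : ℕ} (U : Submodule (ZMod 2) (Fin κ → ZMod 2)) (x : ℝ)
    (v w : Fin κ → ZMod 2) :
    weightThrough U x v - weightThroughPair U x v w
      = ∑ S, if v ∈ S ∧ w ∉ S then lossWeight U x S else 0 := by
  rw [weightThrough, weightThroughPair, ← Finset.sum_sub_distrib]
  refine Finset.sum_congr rfl fun S _ => ?_
  by_cases hv : v ∈ S <;> by_cases hw : w ∈ S <;> simp [hv, hw]

/-- The probability of the random subset `C` of `P`. -/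
noncomputable def subsetProb {α : Type*} (P : Finset α) (x : ℝ) (C : Finset α) : ℝ :=
  (1 - x) ^ C.card * x ^ (P.card - C.card)

lemma subsetProb_nonneg {α : Type*} (P : Finset α) {x : ℝ} (hx0 : 0 ≤ x) (hx1 : x ≤ 1)
    (C : Finset α) : 0 ≤ subsetProb P x C :=
  mul_nonneg (pow_nonneg (sub_nonneg.2 hx1) _) (pow_nonneg hx0 _)

/-- The probability that the random subset of `P` lies in `Q`. -/
lemma sum_subsetProb {α : Type*} {P Q : Finset α} (hQ : Q ⊆ P) (x : ℝ) :
    ∑ C ∈ P.powerset, (if C ⊆ Q then subsetProb P x C else 0) = x ^ (P.card - Q.card) := by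
  rw [← Finset.sum_filter]
  have hset : P.powerset.filter (fun C => C ⊆ Q) = Q.powerset := by
    ext C
    simp only [Finset.mem_filter, Finset.mem_powerset]
    exact ⟨fun h => h.2, fun h => ⟨h.trans hQ, h⟩⟩
  have hone := Finset.sum_pow_mul_eq_add_pow (1 - x) x Q
  rw [sub_add_cancel, one_pow] at hone
  rw [hset, ← one_mul (x ^ _), ← hone, Finset.sum_mul]
  refine Finset.sum_congr rfl fun C hC => ?_
  have h1 := Finset.card_le_card (Finset.mem_powerset.1 hC)
  have h2 := Finset.card_le_card hQ
  rw [subsetProb, mul_assoc, ← pow_add]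
  congr 2
  omega

lemma sum_subsetProb_mul_lossCoeff {κ : ℕ} (P : Finset (Fin κ → ZMod 2)) (x : ℝ)
    (v w : Fin κ → ZMod 2) (p : Finset (Fin κ → ZMod 2) → Prop) :
    ∑ S : Submodule (ZMod 2) (Fin κ → ZMod 2), (if v ∈ S ∧ w ∉ S then lossCoeff S *
        ∑ C ∈ P.powerset, (if p C ∧ (C : Set (Fin κ → ZMod 2)) ⊆ S then subsetProb P x C else 0)
        else 0)
      = ∑ C ∈ P.powerset, subsetProb P x C *
          if p C ∧ w ∉ Submodule.span (ZMod 2) (C : Set (Fin κ → ZMod 2)) ∧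
            v + w ∉ Submodule.span (ZMod 2) (C : Set (Fin κ → ZMod 2)) then 1 else 0 := by
  have h1 : ∀ S : Submodule (ZMod 2) (Fin κ → ZMod 2), (if v ∈ S ∧ w ∉ S then lossCoeff S *
        ∑ C ∈ P.powerset, (if p C ∧ (C : Set (Fin κ → ZMod 2)) ⊆ S then subsetProb P x C else 0)
        else 0) = ∑ C ∈ P.powerset, subsetProb P x C * (if p C then
          (if Submodule.span (ZMod 2) (C : Set (Fin κ → ZMod 2)) ≤ S ∧ v ∈ S ∧ w ∉ S then
            lossCoeff S else 0) else 0) := by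
    intro S
    split_ifs with h
    · rw [Finset.mul_sum]
      refine Finset.sum_congr rfl fun C _ => ?_
      rw [Submodule.span_le]
      by_cases hp : p C <;> by_cases hC : (C : Set (Fin κ → ZMod 2)) ⊆ S <;>
        simp [h, hp, hC, mul_comm]
    · symm
      refine Finset.sum_eq_zero fun C _ => ?_
      simp [h]
  rw [Finset.sum_congr rfl fun S _ => h1 S, Finset.sum_comm]
  refine Finset.sum_congr rfl fun C _ => ?_
  rw [← Finset.mul_sum]
  by_cases hp : p C
  · simp only [hp, if_true, true_and]
    rw [← Finset.sum_filter, sum_lossCoeff_mem_notMem]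
  · simp [hp]

lemma weightThrough_sub_pair_eq {κ : ℕ} (U : Submodule (ZMod 2) (Fin κ → ZMod 2)) (x : ℝ)
    (v w : Fin κ → ZMod 2) :
    weightThrough U x v - weightThroughPair U x v w
      = ∑ C ∈ (offVectors U).powerset, subsetProb (offVectors U) x C *
          if w ∉ Submodule.span (ZMod 2) (C : Set (Fin κ → ZMod 2)) ∧
            v + w ∉ Submodule.span (ZMod 2) (C : Set (Fin κ → ZMod 2)) then 1 else 0 := by
  have h := sum_subsetProb_mul_lossCoeff (offVectors U) x v w (fun _ => True)
  simp only [true_and] at h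
  rw [weightThrough_sub_pair, ← h]
  refine Finset.sum_congr rfl fun S _ => ?_
  congr 1
  rw [lossWeight]
  congr 1
  have h2 := sum_subsetProb (Finset.filter_subset (fun v => v ∈ S) (offVectors U)) x
  have h3 := Finset.card_filter_add_card_filter_not (s := offVectors U) (fun v => v ∈ S)
  rw [← Nat.eq_sub_of_add_eq' h3] at h2
  rw [← h2]
  refine Finset.sum_congr rfl fun C hC => ?_
  congr 1
  rw [Finset.mem_powerset] at hC
  simp only [Finset.subset_iff, Finset.mem_filter, Set.subset_def, SetLike.mem_coe,
    eq_iff_iff]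
  exact ⟨fun h v hv => (h hv).2, fun h v hv => ⟨hC hv, h v hv⟩⟩

lemma mul_weightThrough_sub_pair_eq {κ : ℕ} {U : Submodule (ZMod 2) (Fin κ → ZMod 2)} (x : ℝ)
    {v : Fin κ → ZMod 2} (hv : v ∉ U) (w : Fin κ → ZMod 2) :
    x * (weightThrough U x v - weightThroughPair U x v w)
      = ∑ C ∈ (offVectors U).powerset, subsetProb (offVectors U) x C *
          if v ∉ C ∧ w ∉ Submodule.span (ZMod 2) (C : Set (Fin κ → ZMod 2)) ∧
            v + w ∉ Submodule.span (ZMod 2) (C : Set (Fin κ → ZMod 2)) then 1 else 0 := by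
  have h := sum_subsetProb_mul_lossCoeff (offVectors U) x v w (fun C => v ∉ C)
  rw [weightThrough_sub_pair]
  refine Eq.trans ?_ (h.trans (Finset.sum_congr rfl fun C _ => by congr!))
  rw [Finset.mul_sum]
  refine Finset.sum_congr rfl fun S _ => ?_
  split_ifs with hS
  swap
  · rw [mul_zero]
  rw [lossWeight, mul_left_comm, ← pow_succ']
  congr 1
  have hmem : v ∈ (offVectors U).filter (fun v => v ∈ S) := by
    simp [mem_offVectors, hv, hS.1]
  have h2 := sum_subsetProb ((Finset.erase_subset v _).trans
    (Finset.filter_subset (fun v => v ∈ S) (offVectors U))) x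
  have h3 := Finset.card_filter_add_card_filter_not (s := offVectors U) (fun v => v ∈ S)
  have h4 := Finset.card_erase_add_one hmem
  have h5 : (offVectors U).card - (((offVectors U).filter (fun v => v ∈ S)).erase v).card
      = ((offVectors U).filter (fun v => v ∉ S)).card + 1 := by omega
  rw [h5] at h2
  rw [← h2]
  refine Finset.sum_congr rfl fun C hC => ?_
  congr 1
  rw [Finset.mem_powerset] at hC
  simp only [Finset.subset_iff, Finset.mem_filter, Finset.mem_erase, Set.subset_def,
    SetLike.mem_coe, eq_iff_iff]
  constructor
  · exact fun h => ⟨fun hvC => (h hvC).1 rfl, fun a ha => (h ha).2.2⟩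
  · exact fun h a ha => ⟨fun hav => h.1 (hav ▸ ha), hC ha, h.2 a ha⟩

/-- For a set `C` of vectors off a subspace `U` of index two and `w` off `U`, there are at most as
many `v` off `U` and outside `C` with `w` and `v + w` outside `span C` as there are `v` off `U`
with `v` and `w` outside `span C`. -/
lemma card_notMem_span_le {κ : ℕ} {U : Submodule (ZMod 2) (Fin κ → ZMod 2)}
    (hU : ∀ v w, v ∉ U → w ∉ U → v + w ∈ U) {C : Finset (Fin κ → ZMod 2)}
    (hC : C ⊆ offVectors U) {w : Fin κ → ZMod 2} (hw : w ∉ U) :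
    (((offVectors U).erase w).filter (fun v => v ∉ C ∧
        w ∉ Submodule.span (ZMod 2) (C : Set (Fin κ → ZMod 2)) ∧
        v + w ∉ Submodule.span (ZMod 2) (C : Set (Fin κ → ZMod 2)))).card
      ≤ (((offVectors U).erase w).filter (fun v =>
        v ∉ Submodule.span (ZMod 2) (C : Set (Fin κ → ZMod 2)) ∧
        w ∉ Submodule.span (ZMod 2) (C : Set (Fin κ → ZMod 2)))).card := by
  set T := Submodule.span (ZMod 2) (C : Set (Fin κ → ZMod 2)) with hT
  by_cases hwT : w ∈ T
  · simp [hwT]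
  have hCT : ∀ c ∈ C, c ∈ T := fun c hc => Submodule.subset_span hc
  simp only [hwT, not_false_iff, true_and, and_true]
  have h1 := Finset.card_filter_add_card_filter_not (s := (offVectors U).erase w)
    (fun v => v ∉ C ∧ v + w ∉ T)
  have h2 := Finset.card_filter_add_card_filter_not (s := (offVectors U).erase w) (fun v => v ∉ T)
  suffices h : (((offVectors U).erase w).filter (fun v => ¬ v ∉ T)).card
      ≤ (((offVectors U).erase w).filter (fun v => ¬ (v ∉ C ∧ v + w ∉ T))).card by omega
  rcases C.eq_empty_or_nonempty with rfl | ⟨c, hc⟩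
  · have : ((offVectors U).erase w).filter (fun v => ¬ v ∉ T) = ∅ := by
      refine Finset.filter_eq_empty_iff.2 fun v hv hvT => ?_
      rw [not_not] at hvT
      simp only [hT, Finset.coe_empty, Submodule.span_empty, Submodule.mem_bot] at hvT
      rw [Finset.mem_erase, mem_offVectors, hvT] at hv
      exact hv.2 U.zero_mem
    rw [this, Finset.card_empty]
    exact Nat.zero_le _
  have hcU : c ∉ U := mem_offVectors.1 (hC hc)
  refine Finset.card_le_card_of_injOn (fun v => if v = c then c else v + c + w) ?_ ?_
  · intro v hv
    simp only [Finset.coe_filter, Finset.mem_erase, mem_offVectors, not_not,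
      Set.mem_ofPred_eq] at hv
    obtain ⟨⟨hvw, hvU⟩, hvT⟩ := hv
    simp only [Finset.coe_filter, Finset.mem_erase, mem_offVectors, Set.mem_ofPred_eq]
    split_ifs with hvc
    · exact ⟨⟨fun h => hwT (h ▸ hCT c hc), hcU⟩, fun h => h.1 hc⟩
    · refine ⟨⟨fun h => hvc ?_, fun h => hw ?_⟩, fun h => h.2 ?_⟩
      · have h0 : v + c = 0 := by simpa using h
        calc v = v + c + c := by rw [add_assoc, add_self_zmod_two, add_zero]
          _ = c := by rw [h0, zero_add]
      · have := U.sub_mem h (hU v c hvU hcU)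
        rwa [add_sub_cancel_left] at this
      · rw [add_assoc, add_self_zmod_two, add_zero]
        exact T.add_mem hvT (hCT c hc)
  · have key : ∀ v ∈ T, c ≠ v + c + w := fun v hv h => hwT (by
      have h0 : v + w = 0 := by
        have : c = c + (v + w) := by rw [add_comm v c, add_assoc] at h; exact h
        simpa using this
      have : w = v := by
        calc w = v + v + w := by rw [add_self_zmod_two, zero_add]
          _ = v := by rw [add_assoc, h0, add_zero]
      exact this ▸ hv)
    intro a ha b hb hab
    simp only [Finset.coe_filter, Finset.mem_erase, mem_offVectors, not_not,
      Set.mem_ofPred_eq] at ha hb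
    simp only at hab
    split_ifs at hab with h1 h2 h2
    · exact h1.trans h2.symm
    · exact absurd hab (key b hb.2)
    · exact absurd hab.symm (key a ha.2)
    · simpa using hab

lemma lossWeight_map {κ : ℕ} {U : Submodule (ZMod 2) (Fin κ → ZMod 2)} (x : ℝ)
    (e : (Fin κ → ZMod 2) ≃ₗ[ZMod 2] (Fin κ → ZMod 2)) (he : ∀ v, e v ∈ U ↔ v ∈ U)
    (S : Submodule (ZMod 2) (Fin κ → ZMod 2)) :
    lossWeight U x (Submodule.orderIsoMapComap e S) = lossWeight U x S := by
  have hmem : ∀ v, e v ∈ Submodule.orderIsoMapComap e S ↔ v ∈ S := fun v => by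
    simp [Submodule.orderIsoMapComap_apply]
  have hcard : ((offVectors U).filter (fun v => v ∉ S)).card
      = ((offVectors U).filter (fun v => v ∉ Submodule.orderIsoMapComap e S)).card := by
    refine Finset.card_equiv e.toEquiv fun v => ?_
    simp only [Finset.mem_filter, mem_offVectors, LinearEquiv.coe_toEquiv, he, hmem]
  have hfin : Module.finrank (ZMod 2) (Submodule.orderIsoMapComap e S) =
      Module.finrank (ZMod 2) S := by
    rw [Submodule.orderIsoMapComap_apply]
    exact LinearEquiv.finrank_map_eq e S
  have htop : Submodule.orderIsoMapComap e S = ⊤ ↔ S = ⊤ := by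
    conv_lhs => rw [← (Submodule.orderIsoMapComap e).map_top, EmbeddingLike.apply_eq_iff_eq]
  rw [lossWeight, lossWeight, ← hcard, lossCoeff, lossCoeff, hfin]
  simp only [htop]

lemma weightThrough_map {κ : ℕ} {U : Submodule (ZMod 2) (Fin κ → ZMod 2)} (x : ℝ)
    (e : (Fin κ → ZMod 2) ≃ₗ[ZMod 2] (Fin κ → ZMod 2)) (he : ∀ v, e v ∈ U ↔ v ∈ U)
    (v : Fin κ → ZMod 2) : weightThrough U x (e v) = weightThrough U x v := by
  rw [weightThrough, ← Equiv.sum_comp (Submodule.orderIsoMapComap e).toEquiv]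
  refine Finset.sum_congr rfl fun S _ => ?_
  rw [RelIso.coe_fn_toEquiv, lossWeight_map x e he]
  simp [Submodule.orderIsoMapComap_apply]

lemma weightThroughPair_map {κ : ℕ} {U : Submodule (ZMod 2) (Fin κ → ZMod 2)} (x : ℝ)
    (e : (Fin κ → ZMod 2) ≃ₗ[ZMod 2] (Fin κ → ZMod 2)) (he : ∀ v, e v ∈ U ↔ v ∈ U)
    (v w : Fin κ → ZMod 2) :
    weightThroughPair U x (e v) (e w) = weightThroughPair U x v w := by
  rw [weightThroughPair, ← Equiv.sum_comp (Submodule.orderIsoMapComap e).toEquiv]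
  refine Finset.sum_congr rfl fun S _ => ?_
  rw [RelIso.coe_fn_toEquiv, lossWeight_map x e he]
  simp [Submodule.orderIsoMapComap_apply]

/-- Two vectors congruent modulo `U` are exchanged by a transvection preserving `U`, which fixes
the vectors of a subspace `T` containing their sum but neither of them. -/
lemma exists_linearEquiv_swap {κ : ℕ} {U T : Submodule (ZMod 2) (Fin κ → ZMod 2)}
    {v v' : Fin κ → ZMod 2} (hU : v + v' ∈ U) (hT : v + v' ∈ T) (hv : v ∉ T) :
    ∃ e : (Fin κ → ZMod 2) ≃ₗ[ZMod 2] (Fin κ → ZMod 2),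
      (∀ a, e a ∈ U ↔ a ∈ U) ∧ (∀ a ∈ T, e a = a) ∧ e v = v' := by
  obtain ⟨f, hfv, hfT⟩ := exists_functional_eq_one hv
  have hfy : f (v + v') = 0 := hfT _ hT
  let g : (Fin κ → ZMod 2) →ₗ[ZMod 2] (Fin κ → ZMod 2) :=
    LinearMap.id + f.smulRight (v + v')
  have hg : ∀ a, g a = a + f a • (v + v') := fun a => rfl
  have hinv : Function.Involutive g := fun a => by
    rw [hg, hg, map_add, map_smul, hfy, smul_zero, add_zero, add_assoc, add_self_zmod_two,
      add_zero]
  refine ⟨LinearEquiv.ofInvolutive g hinv, fun a => ?_, fun a ha => ?_, ?_⟩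
  · change g a ∈ U ↔ a ∈ U
    rw [hg]
    exact U.add_mem_iff_left (U.smul_mem _ hU)
  · change g a = a
    rw [hg, hfT a ha, zero_smul, add_zero]
  · change g v = v'
    rw [hg, hfv, one_smul, ← add_assoc, add_self_zmod_two, zero_add]

lemma eq_of_add_eq_zero_zmod_two {κ : ℕ} {v w : Fin κ → ZMod 2} (h : v + w = 0) : v = w := by
  calc v = v + w + w := by rw [add_assoc, add_self_zmod_two, add_zero]
    _ = w := by rw [h, zero_add]

lemma weightThrough_congr {κ : ℕ} {U : Submodule (ZMod 2) (Fin κ → ZMod 2)} (x : ℝ)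
    {v v' : Fin κ → ZMod 2} (hU : v + v' ∈ U) (hv : v ≠ 0) (hv' : v' ≠ 0) :
    weightThrough U x v = weightThrough U x v' := by
  obtain ⟨e, he, -, hev⟩ := exists_linearEquiv_swap
    (T := ⊥ ⊔ Submodule.span (ZMod 2) {v + v'}) hU
    (Submodule.mem_sup_right (Submodule.mem_span_singleton_self _)) (v := v) (by
      rw [mem_sup_span_singleton_zmod_two, Submodule.mem_bot, Submodule.mem_bot, add_right_comm,
        add_self_zmod_two, zero_add]
      tauto)
  rw [← hev, weightThrough_map x e he]

lemma weightThroughPair_congr {κ : ℕ} {U : Submodule (ZMod 2) (Fin κ → ZMod 2)} (x : ℝ)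
    {v v' w : Fin κ → ZMod 2} (hU : v + v' ∈ U) (hv : v ≠ 0) (hv' : v' ≠ 0) (hvw : v ≠ w)
    (hvw' : v' ≠ w) : weightThroughPair U x v w = weightThroughPair U x v' w := by
  obtain ⟨e, he, hfix, hev⟩ := exists_linearEquiv_swap
    (T := (⊥ ⊔ Submodule.span (ZMod 2) {w}) ⊔ Submodule.span (ZMod 2) {v + v'}) hU
    (Submodule.mem_sup_right (Submodule.mem_span_singleton_self _)) (v := v) (by
      rw [mem_sup_span_singleton_zmod_two, add_right_comm, add_self_zmod_two, zero_add,
        mem_sup_span_singleton_zmod_two, mem_sup_span_singleton_zmod_two]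
      simp only [Submodule.mem_bot]
      rintro ((h | h) | (h | h))
      · exact hv h
      · exact hvw (eq_of_add_eq_zero_zmod_two h).symm
      · exact hv' h
      · exact hvw' (eq_of_add_eq_zero_zmod_two h).symm)
  have hw : e w = w := hfix w (Submodule.mem_sup_left (Submodule.mem_sup_right
    (Submodule.mem_span_singleton_self _)))
  calc _ = weightThroughPair U x (e v) (e w) := (weightThroughPair_map x e he v w).symm
    _ = _ := by rw [hev, hw]

lemma weightThroughPair_comm {κ : ℕ} (U : Submodule (ZMod 2) (Fin κ → ZMod 2)) (x : ℝ)
    (v w : Fin κ → ZMod 2) : weightThroughPair U x v w = weightThroughPair U x w v := by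
  simp only [weightThroughPair, and_comm]

lemma weightThroughPair_add {κ : ℕ} (U : Submodule (ZMod 2) (Fin κ → ZMod 2)) (x : ℝ)
    (v w : Fin κ → ZMod 2) :
    weightThroughPair U x (v + w) v = weightThroughPair U x v w := by
  refine Finset.sum_congr rfl fun S _ => ?_
  congr 1
  rw [eq_iff_iff, and_comm]
  exact and_congr_right fun hv => S.add_mem_iff_right hv

lemma weightThroughPair_self {κ : ℕ} (U : Submodule (ZMod 2) (Fin κ → ZMod 2)) (x : ℝ)
    (v : Fin κ → ZMod 2) : weightThroughPair U x v v = weightThrough U x v := by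
  simp only [weightThroughPair, weightThrough, and_self]

/-- All pairs of distinct vectors outside a subspace of index two carry the same weight. -/
lemma weightThroughPair_eq {κ : ℕ} {U : Submodule (ZMod 2) (Fin κ → ZMod 2)} (x : ℝ)
    (hU : ∀ v w, v ∉ U → w ∉ U → v + w ∈ U) {v w v' w' : Fin κ → ZMod 2} (hv : v ∉ U)
    (hw : w ∉ U) (hv' : v' ∉ U) (hw' : w' ∉ U) (hvw : v ≠ w) (hvw' : v' ≠ w') :
    weightThroughPair U x v w = weightThroughPair U x v' w' := by
  have h0 : ∀ a, a ∉ U → a ≠ 0 := fun a ha h => ha (h ▸ U.zero_mem)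
  have step : ∀ a b c, a ∉ U → b ∉ U → a ≠ c → b ≠ c →
      weightThroughPair U x a c = weightThroughPair U x b c := fun a b c ha hb hac hbc =>
    weightThroughPair_congr x (hU a b ha hb) (h0 a ha) (h0 b hb) hac hbc
  by_cases h : v' = w
  · subst h
    rw [weightThroughPair_comm U x v' w']
    exact step _ _ _ hv hw' hvw hvw'.symm
  · rw [step v v' w hv hv' hvw h, weightThroughPair_comm, weightThroughPair_comm U x v' w']
    exact step _ _ _ hw hw' (Ne.symm h) hvw'.symm

lemma weightThroughPair_lt {κ : ℕ} (U : Submodule (ZMod 2) (Fin κ → ZMod 2)) {x : ℝ}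
    (hx0 : 0 < x) (hx1 : x ≤ 1) {v w : Fin κ → ZMod 2} (hw : w ≠ 0) (hvw : v ≠ w) :
    weightThroughPair U x v w < weightThrough U x v := by
  rw [← sub_pos, weightThrough_sub_pair_eq]
  refine Finset.sum_pos' (fun C _ => mul_nonneg (subsetProb_nonneg _ hx0.le hx1 _) ?_)
    ⟨∅, Finset.empty_mem_powerset _, ?_⟩
  · split_ifs <;> norm_num
  · have : v + w ≠ 0 := fun h => hvw (eq_of_add_eq_zero_zmod_two h)
    simp only [Finset.coe_empty, Submodule.span_empty, Submodule.mem_bot]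
    rw [if_pos ⟨hw, this⟩, subsetProb]
    simp only [Finset.card_empty, pow_zero, one_mul, mul_one]
    positivity

/-- Comparison of the first-order weights on and off a subspace of index two. -/
lemma mul_weight_sub_le {κ : ℕ} {U : Submodule (ZMod 2) (Fin κ → ZMod 2)} {x : ℝ}
    (hx0 : 0 ≤ x) (hx1 : x ≤ 1) (hU : ∀ v w, v ∉ U → w ∉ U → v + w ∈ U)
    {v w : Fin κ → ZMod 2} (hv : v ∉ U) (hw : w ∉ U) (hvw : v ≠ w) :
    x * (weightThrough U x v - weightThroughPair U x v w)
      ≤ weightThrough U x (v + w) - weightThroughPair U x v w := by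
  have h0 : ∀ a, a ∉ U → a ≠ 0 := fun a ha h => ha (h ▸ U.zero_mem)
  have hadd : ∀ a b : Fin κ → ZMod 2, a ≠ b → a + b ≠ 0 := fun a b hab h =>
    hab (eq_of_add_eq_zero_zmod_two h)
  have hmem : v ∈ (offVectors U).erase w :=
    Finset.mem_erase.2 ⟨hvw, mem_offVectors.2 hv⟩
  have hpos : (0 : ℝ) < ((offVectors U).erase w).card :=
    Nat.cast_pos.2 (Finset.card_pos.2 ⟨v, hmem⟩)
  refine le_of_mul_le_mul_left ?_ hpos
  have hl : ∀ a ∈ (offVectors U).erase w,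
      x * (weightThrough U x a - weightThroughPair U x a w)
        = x * (weightThrough U x v - weightThroughPair U x v w) := by
    intro a ha
    obtain ⟨haw, ha⟩ := Finset.mem_erase.1 ha
    rw [mem_offVectors] at ha
    rw [weightThrough_congr x (hU a v ha hv) (h0 a ha) (h0 v hv),
      weightThroughPair_eq x hU ha hw hv hw haw hvw]
  have hr : ∀ a ∈ (offVectors U).erase w,
      weightThrough U x (a + w) - weightThroughPair U x (a + w) a
        = weightThrough U x (v + w) - weightThroughPair U x v w := by
    intro a ha
    obtain ⟨haw, ha⟩ := Finset.mem_erase.1 ha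
    rw [mem_offVectors] at ha
    rw [weightThroughPair_add, weightThroughPair_eq x hU ha hw hv hw haw hvw,
      weightThrough_congr x (v := a + w) (v' := v + w)
        (U.add_mem (hU _ _ ha hw) (hU _ _ hv hw)) (hadd _ _ haw) (hadd _ _ hvw)]
  rw [← nsmul_eq_mul, ← nsmul_eq_mul, ← Finset.sum_const, ← Finset.sum_const,
    ← Finset.sum_congr rfl hl, ← Finset.sum_congr rfl hr]
  have hl' : ∀ a ∈ (offVectors U).erase w, _ := fun a ha =>
    mul_weightThrough_sub_pair_eq x (mem_offVectors.1 (Finset.mem_erase.1 ha).2) w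
  rw [Finset.sum_congr rfl hl', Finset.sum_congr rfl fun a _ => weightThrough_sub_pair_eq U x _ a,
    Finset.sum_comm, Finset.sum_comm (s := (offVectors U).erase w)]
  refine Finset.sum_le_sum fun C hC => ?_
  rw [← Finset.mul_sum, ← Finset.mul_sum]
  refine mul_le_mul_of_nonneg_left ?_ (subsetProb_nonneg _ hx0 hx1 C)
  have hcancel : ∀ a : Fin κ → ZMod 2, a + w + a = w := fun a => by
    rw [add_right_comm, add_self_zmod_two, zero_add]
  simp only [hcancel]
  rw [Finset.sum_boole, Finset.sum_boole]
  exact_mod_cast card_notMem_span_le hU (Finset.mem_powerset.1 hC) hw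

lemma abs_zeta_le {κ : ℕ} (S : Submodule (ZMod 2) (Fin κ → ZMod 2))
    (d : (Fin κ → ZMod 2) → ℝ) : |zeta κ S d| ≤ ∑ v, |d v| := by
  refine (Finset.abs_sum_le_sum_abs _ _).trans (Finset.sum_le_sum fun v _ => ?_)
  split_ifs
  · exact le_rfl
  · rw [abs_zero]; exact abs_nonneg _

lemma zeta_add {κ : ℕ} (S : Submodule (ZMod 2) (Fin κ → ZMod 2))
    (d e : (Fin κ → ZMod 2) → ℝ) : zeta κ S (fun v => d v + e v) = zeta κ S d + zeta κ S e := by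
  rw [zeta, zeta, zeta, ← Finset.sum_add_distrib]
  refine Finset.sum_congr rfl fun v _ => ?_
  split_ifs <;> simp

lemma zeta_sub {κ : ℕ} (S : Submodule (ZMod 2) (Fin κ → ZMod 2))
    (d e : (Fin κ → ZMod 2) → ℝ) : zeta κ S (fun v => d v - e v) = zeta κ S d - zeta κ S e := by
  rw [zeta, zeta, zeta, ← Finset.sum_sub_distrib]
  refine Finset.sum_congr rfl fun v _ => ?_
  split_ifs <;> simp

lemma sum_lossWeight_mul_zeta {κ : ℕ} (U : Submodule (ZMod 2) (Fin κ → ZMod 2)) (x : ℝ)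
    (d : (Fin κ → ZMod 2) → ℝ) :
    ∑ S, lossWeight U x S * zeta κ S d = ∑ v, d v * weightThrough U x v := by
  simp only [zeta, weightThrough, Finset.mul_sum]
  rw [Finset.sum_comm]
  refine Finset.sum_congr rfl fun v _ => Finset.sum_congr rfl fun S _ => ?_
  split_ifs
  · exact mul_comm _ _
  · rw [mul_zero, mul_zero]

lemma sum_lossWeight_mul_zeta_sq {κ : ℕ} (U : Submodule (ZMod 2) (Fin κ → ZMod 2)) (x : ℝ)
    (d : (Fin κ → ZMod 2) → ℝ) :
    ∑ S, lossWeight U x S * zeta κ S d ^ 2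
      = ∑ v, ∑ w, d v * d w * weightThroughPair U x v w := by
  have hsq : ∀ S, zeta κ S d ^ 2
      = ∑ v, ∑ w, (if v ∈ S then d v else 0) * (if w ∈ S then d w else 0) := fun S => by
    rw [sq, zeta, Finset.sum_mul_sum]
  simp only [hsq, weightThroughPair, Finset.mul_sum]
  rw [Finset.sum_comm]
  refine Finset.sum_congr rfl fun v _ => ?_
  rw [Finset.sum_comm]
  refine Finset.sum_congr rfl fun w _ => Finset.sum_congr rfl fun S _ => ?_
  by_cases hv : v ∈ S <;> by_cases hw : w ∈ S <;> simp [hv, hw, mul_comm]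

/-- The quadratic form of the pair weights is, on vectors supported off a subspace of index two,
a combination of the squared sum and the squared norm. -/
lemma sum_lossWeight_mul_zeta_sq_of_support {κ : ℕ} {U : Submodule (ZMod 2) (Fin κ → ZMod 2)}
    (x : ℝ) (hU : ∀ v w, v ∉ U → w ∉ U → v + w ∈ U) {v w : Fin κ → ZMod 2} (hv : v ∉ U)
    (hw : w ∉ U) (hvw : v ≠ w) {p : (Fin κ → ZMod 2) → ℝ} (hp : ∀ a ∈ U, p a = 0) :
    ∑ S, lossWeight U x S * zeta κ S p ^ 2
      = weightThroughPair U x v w * (∑ a, p a) ^ 2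
        + (weightThrough U x v - weightThroughPair U x v w) * ∑ a, p a ^ 2 := by
  have h0 : ∀ a, a ∉ U → a ≠ 0 := fun a ha h => ha (h ▸ U.zero_mem)
  have hterm : ∀ a b, p a * p b * weightThroughPair U x a b
      = weightThroughPair U x v w * (p a * p b)
        + if b = a then (weightThrough U x v - weightThroughPair U x v w) * p a ^ 2 else 0 := by
    intro a b
    by_cases ha : a ∈ U
    · simp [hp a ha]
    by_cases hb : b ∈ U
    · have : b ≠ a := fun h => ha (h ▸ hb)
      simp [hp b hb, this]
    split_ifs with hba
    · rw [hba, weightThroughPair_self, weightThrough_congr x (hU a v ha hv) (h0 a ha) (h0 v hv)]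
      ring
    · rw [weightThroughPair_eq x hU ha hb hv hw (Ne.symm hba) hvw]
      ring
  rw [sum_lossWeight_mul_zeta_sq]
  simp only [hterm, Finset.sum_add_distrib, Finset.sum_ite_eq', Finset.mem_univ, if_true,
    ← Finset.mul_sum]
  rw [sq (∑ a, p a), Finset.sum_mul_sum]
  simp only [Finset.mul_sum]

lemma sum_mul_weightThrough {κ : ℕ} {U : Submodule (ZMod 2) (Fin κ → ZMod 2)}
    (x : ℝ) (hU : ∀ v w, v ∉ U → w ∉ U → v + w ∈ U) {u v : Fin κ → ZMod 2} (hu : u ∈ U)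
    (hu0 : u ≠ 0) (hv : v ∉ U) {d : (Fin κ → ZMod 2) → ℝ} (hd0 : d 0 = 0)
    (hd : ∑ a, d a = 0) :
    ∑ a, d a * weightThrough U x a
      = (weightThrough U x u - weightThrough U x v) * zeta κ U d := by
  have h0 : ∀ a, a ∉ U → a ≠ 0 := fun a ha h => ha (h ▸ U.zero_mem)
  have hterm : ∀ a, d a * weightThrough U x a = weightThrough U x v * d a
      + (weightThrough U x u - weightThrough U x v) * (if a ∈ U then d a else 0) := by
    intro a
    split_ifs with ha
    · by_cases ha0 : a = 0
      · simp [ha0, hd0]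
      · rw [weightThrough_congr x (U.add_mem ha hu) ha0 hu0]
        ring
    · rw [weightThrough_congr x (hU a v ha hv) (h0 a ha) (h0 v hv)]
      ring
  simp only [hterm, Finset.sum_add_distrib, ← Finset.mul_sum, hd, mul_zero, zero_add, zeta]

lemma abs_exp_sub_quadratic_le {y : ℝ} (hy : |y| ≤ 1) :
    |Real.exp y - 1 - (y + y ^ 2 / 2)| ≤ |y| ^ 3 := by
  have h := Real.exp_bound hy (n := 3) (by norm_num)
  simp only [Finset.sum_range_succ, Finset.sum_range_zero, pow_zero, pow_one, zero_add] at h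
  norm_num [Nat.factorial] at h
  have h3 : 0 ≤ |y| ^ 3 := by positivity
  have heq : Real.exp y - 1 - (y + y ^ 2 / 2) = Real.exp y - (1 + y + y ^ 2 / 2) := by ring
  rw [heq]
  linarith

/-- Quantitative second-order estimate: small perturbations of the subspace exclusion code which
keep the fixed-radius constraint do not decrease the loss, provided the second-order coefficient
dominates the error. -/
lemma sum_lossWeight_mul_exp_nonneg {κ : ℕ} {U : Submodule (ZMod 2) (Fin κ → ZMod 2)}
    {x a N : ℝ} (ha : 0 < a) (hN : 0 < N) (hcard : (Fintype.card (Fin κ → ZMod 2) : ℝ) = 2 * N)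
    (hU : ∀ v w, v ∉ U → w ∉ U → v + w ∈ U) {v w : Fin κ → ZMod 2} (hv : v ∉ U) (hw : w ∉ U)
    (hvw : v ≠ w) (hlt : weightThroughPair U x v w ≤ weightThrough U x v)
    {d : (Fin κ → ZMod 2) → ℝ} (hd0 : d 0 = 0) (hdU : ∀ b ∈ U, 0 ≤ d b)
    (hd : ∑ b, d b = 0) (hs : zeta κ U d = N / 2 * ∑ b, d b ^ 2)
    (hsmall : a * ∑ b, |d b| ≤ 1)
    (hC : (a ^ 2 / 2 * (|weightThroughPair U x v w| * (N / 2)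
        + (weightThrough U x v - weightThroughPair U x v w) * (N / 2)
        + (∑ S, |lossWeight U x S|) * N) + (∑ S, |lossWeight U x S|) * a ^ 3 * (2 * N))
        * ∑ b, |d b|
      ≤ a * (weightThrough U x (v + w) - weightThrough U x v) * (N / 2)
        + a ^ 2 / 2 * (weightThrough U x v - weightThroughPair U x v w)) :
    0 ≤ ∑ S, lossWeight U x S * (Real.exp (a * zeta κ S d) - 1) := by
  set B := ∑ S, |lossWeight U x S| with hB
  set L := ∑ b, |d b| with hL
  set D := ∑ b, d b ^ 2 with hD
  set s := zeta κ U d with hsdef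
  set M := weightThroughPair U x v w with hM
  set G := weightThrough U x v with hG
  set G' := weightThrough U x (v + w) with hG'
  have hB0 : 0 ≤ B := Finset.sum_nonneg fun S _ => abs_nonneg _
  have hL0 : 0 ≤ L := Finset.sum_nonneg fun b _ => abs_nonneg _
  have hD0 : 0 ≤ D := Finset.sum_nonneg fun b _ => sq_nonneg _
  have hs0 : 0 ≤ s := by rw [hs]; positivity
  have hsL : s ≤ L := (le_abs_self _).trans (abs_zeta_le U d)
  have hLD : L ^ 2 ≤ 2 * N * D := by
    have := sq_sum_le_card_mul_sum_sq (s := Finset.univ) (f := fun b => |d b|)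
    simpa only [sq_abs, Finset.card_univ, hcard] using this
  -- the parts of the perturbation on and off `U`
  set r : (Fin κ → ZMod 2) → ℝ := fun b => if b ∈ U then d b else 0 with hr
  set p : (Fin κ → ZMod 2) → ℝ := fun b => if b ∈ U then 0 else d b with hp
  have hpr : ∀ b, p b + r b = d b := fun b => by simp only [hp, hr]; split_ifs <;> simp
  have hr0 : ∀ b, 0 ≤ r b := fun b => by
    simp only [hr]; split_ifs with h
    · exact hdU b h
    · exact le_rfl
  have hrs : ∑ b, r b = s := rfl
  have hps : ∑ b, p b = -s := by
    have : ∑ b, p b + ∑ b, r b = 0 := by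
      rw [← Finset.sum_add_distrib, ← hd]
      exact Finset.sum_congr rfl fun b _ => hpr b
    linarith
  have hz : ∀ S, zeta κ S d = zeta κ S p + zeta κ S r := fun S => by
    rw [← zeta_add]
    simp only [hpr]
  have hzr0 : ∀ S, 0 ≤ zeta κ S r := fun S => Finset.sum_nonneg fun b _ => by
    split_ifs
    · exact hr0 b
    · exact le_rfl
  have hzrs : ∀ S, zeta κ S r ≤ s := fun S => by
    rw [← hrs]
    refine Finset.sum_le_sum fun b _ => ?_
    split_ifs
    · exact le_rfl
    · exact hr0 b
  have hzL : ∀ S, |zeta κ S d| ≤ L := fun S => abs_zeta_le S d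
  have hpL : ∀ S, |zeta κ S p| ≤ L := fun S => by
    refine (abs_zeta_le S p).trans (Finset.sum_le_sum fun b _ => ?_)
    simp only [hp]; split_ifs
    · rw [abs_zero]; exact abs_nonneg _
    · exact le_rfl
  have hTaylor : ∑ S, lossWeight U x S * (a * zeta κ S d + (a * zeta κ S d) ^ 2 / 2)
      - B * (a * L) ^ 3 ≤ ∑ S, lossWeight U x S * (Real.exp (a * zeta κ S d) - 1) := by
    rw [hB, Finset.sum_mul, ← Finset.sum_sub_distrib]
    refine Finset.sum_le_sum fun S _ => ?_
    have hy : |a * zeta κ S d| ≤ a * L := by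
      rw [abs_mul, abs_of_pos ha]
      exact mul_le_mul_of_nonneg_left (hzL S) ha.le
    have h1 := (abs_exp_sub_quadratic_le (hy.trans hsmall)).trans
      (pow_le_pow_left₀ (abs_nonneg _) hy 3)
    have h2 := mul_le_mul_of_nonneg_left h1 (abs_nonneg (lossWeight U x S))
    rw [← abs_mul] at h2
    have h3 := (abs_le.1 h2).1
    linarith
  have hquad : ∑ S, lossWeight U x S * zeta κ S p ^ 2 - B * (s * (2 * L))
      ≤ ∑ S, lossWeight U x S * zeta κ S d ^ 2 := by
    rw [hB, Finset.sum_mul, ← Finset.sum_sub_distrib]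
    refine Finset.sum_le_sum fun S _ => ?_
    have h1 : |zeta κ S d ^ 2 - zeta κ S p ^ 2| ≤ s * (2 * L) := by
      have heq : zeta κ S d ^ 2 - zeta κ S p ^ 2
          = zeta κ S r * (zeta κ S d + zeta κ S p) := by rw [hz S]; ring
      rw [heq, abs_mul, abs_of_nonneg (hzr0 S)]
      refine mul_le_mul (hzrs S) ?_ (abs_nonneg _) hs0
      have := abs_add_le (zeta κ S d) (zeta κ S p)
      linarith [hzL S, hpL S]
    have h2 := mul_le_mul_of_nonneg_left h1 (abs_nonneg (lossWeight U x S))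
    rw [← abs_mul] at h2
    have h3 := (abs_le.1 h2).1
    linarith
  have hform := sum_lossWeight_mul_zeta_sq_of_support x hU hv hw hvw (p := p)
    (fun b hb => if_pos hb)
  rw [hps, ← hM, ← hG] at hform
  have hpD : D - s * L ≤ ∑ b, p b ^ 2 := by
    rw [hD, ← hrs, Finset.sum_mul, ← Finset.sum_sub_distrib]
    refine Finset.sum_le_sum fun b _ => ?_
    have hbL : |d b| ≤ L :=
      Finset.single_le_sum (f := fun b => |d b|) (fun b _ => abs_nonneg _) (Finset.mem_univ b)
    simp only [hp, hr]; split_ifs with hb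
    · have h1 := mul_le_mul_of_nonneg_left ((le_abs_self (d b)).trans hbL) (hdU b hb)
      linarith [sq (d b)]
    · simp
  have hlin : ∑ S, lossWeight U x S * zeta κ S d = (G' - G) * s := by
    rw [sum_lossWeight_mul_zeta]
    exact sum_mul_weightThrough x hU (hU v w hv hw)
      (fun h => hvw (eq_of_add_eq_zero_zmod_two h)) hv hd0 hd
  have hsplit : ∑ S, lossWeight U x S * (a * zeta κ S d + (a * zeta κ S d) ^ 2 / 2)
      = a * ∑ S, lossWeight U x S * zeta κ S d
        + a ^ 2 / 2 * ∑ S, lossWeight U x S * zeta κ S d ^ 2 := by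
    rw [Finset.mul_sum, Finset.mul_sum, ← Finset.sum_add_distrib]
    exact Finset.sum_congr rfl fun S _ => by ring
  have hMs : -(|M| * (s * L)) ≤ M * (-s) ^ 2 := by
    have h1 : s * s ≤ s * L := mul_le_mul_of_nonneg_left hsL hs0
    have h2 : |M * (s * s)| ≤ |M| * (s * L) := by
      rw [abs_mul, abs_of_nonneg (mul_nonneg hs0 hs0)]
      exact mul_le_mul_of_nonneg_left h1 (abs_nonneg M)
    have := (abs_le.1 h2).1
    linarith [show M * (-s) ^ 2 = M * (s * s) by ring]
  have hGM : (G - M) * (D - s * L) ≤ (G - M) * ∑ b, p b ^ 2 :=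
    mul_le_mul_of_nonneg_left hpD (sub_nonneg.2 hlt)
  have hcube : B * (a * L) ^ 3 ≤ B * a ^ 3 * (2 * N) * (D * L) := by
    have := mul_le_mul_of_nonneg_left (mul_le_mul_of_nonneg_right hLD hL0)
      (show 0 ≤ B * a ^ 3 by positivity)
    linarith
  have hsecond : -(|M| * (s * L)) + (G - M) * (D - s * L) - B * (s * (2 * L))
      ≤ ∑ S, lossWeight U x S * zeta κ S d ^ 2 := by linarith
  have hsecond' := mul_le_mul_of_nonneg_left hsecond (show 0 ≤ a ^ 2 / 2 by positivity)
  have hfinal := mul_le_mul_of_nonneg_left hC hD0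
  rw [hsplit, hlin] at hTaylor
  rw [hs] at hTaylor hsecond'
  refine le_trans ?_ hTaylor
  linarith

lemma eqLoss_eq_sum {κ n : ℕ} {ε : ℝ} (hε : 0 < ε) (q : (Fin κ → ZMod 2) → ℝ) :
    eqLoss κ n ε q = (n : ℝ) * (1 - ε) - κ
      + ∑ S, lossCoeff S * Real.exp (Real.log ε * (n * (1 - zeta κ S q))) := by
  rw [eqLoss]
  congr 1
  have hle : ∀ S : Submodule (ZMod 2) (Fin κ → ZMod 2), Module.finrank (ZMod 2) S ≤ κ :=
    fun S => by simpa using Submodule.finrank_le S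
  have htop : ∀ S : Submodule (ZMod 2) (Fin κ → ZMod 2), S ≠ ⊤ →
      κ - Module.finrank (ZMod 2) S ∈ Finset.Icc 1 κ := fun S hS => by
    have := Submodule.finrank_lt hS
    rw [Module.finrank_fin_fun] at this
    rw [Finset.mem_Icc]
    omega
  symm
  rw [← Finset.sum_filter_of_ne
      (p := fun S : Submodule (ZMod 2) (Fin κ → ZMod 2) => S ≠ ⊤)
      (fun S _ hS h => hS (by simp [lossCoeff, h])),
    ← Finset.sum_fiberwise_of_maps_to
      (g := fun S : Submodule (ZMod 2) (Fin κ → ZMod 2) => κ - Module.finrank (ZMod 2) S)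
      (fun S hS => htop S (Finset.mem_filter.1 hS).2)]
  refine Finset.sum_congr rfl fun δ hδ => ?_
  rw [Finset.mem_Icc] at hδ
  rw [Finset.mul_sum]
  refine Finset.sum_congr ?_ fun S hS => ?_
  · ext S
    simp only [Finset.mem_filter, Finset.mem_univ, true_and]
    have := hle S
    constructor
    · rintro ⟨-, h⟩
      omega
    · intro h
      refine ⟨fun hS => ?_, by omega⟩
      rw [hS, finrank_top, Module.finrank_fin_fun] at h
      omega
  · have hr : Module.finrank (ZMod 2) S = κ - δ := (Finset.mem_filter.1 hS).2
    have hS' : S ≠ ⊤ := by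
      rintro rfl
      rw [finrank_top, Module.finrank_fin_fun] at hr
      omega
    have hSδ : κ - Module.finrank (ZMod 2) S = δ := by omega
    rw [lossCoeff, if_neg hS', hSδ, Real.rpow_def_of_pos hε]

lemma exists_index_two {κ : ℕ} (hκ : 1 ≤ κ) {U : Submodule (ZMod 2) (Fin κ → ZMod 2)}
    (hU : Module.finrank (ZMod 2) U = κ - 1) : ∀ v w, v ∉ U → w ∉ U → v + w ∈ U := by
  intro v w hv hw
  obtain ⟨f, hfv, hfU⟩ := exists_functional_eq_one hv
  have hf0 : f ≠ 0 := fun h => by simp [h] at hfv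
  have hker : Module.finrank (ZMod 2) (LinearMap.ker f) + 1 = κ := by
    have := Module.Dual.finrank_ker_add_one_of_ne_zero hf0
    simpa using this
  have hUf : U = LinearMap.ker f := Submodule.eq_of_le_of_finrank_eq hfU (by omega)
  have hfw : f w = 1 := zmod_two_eq_one fun h => hw (by rw [hUf]; exact h)
  rw [hUf, LinearMap.mem_ker, map_add, hfv, hfw]
  decide

lemma card_offVectors {κ : ℕ} (hκ : 1 ≤ κ) {U : Submodule (ZMod 2) (Fin κ → ZMod 2)}
    (hU : Module.finrank (ZMod 2) U = κ - 1) : (offVectors U).card = 2 ^ (κ - 1) := by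
  have h1 := Finset.card_filter_add_card_filter_not (s := Finset.univ) (fun v => v ∈ U)
  rw [card_filter_mem, hU, Finset.card_univ, Fintype.card_fun, ZMod.card, Fintype.card_fin] at h1
  obtain ⟨k, rfl⟩ := Nat.exists_eq_add_of_le' hκ
  rw [Nat.add_sub_cancel, pow_succ] at h1
  rw [Nat.add_sub_cancel, offVectors]
  omega

lemma qcheck_apply {κ : ℕ} (hκ : 1 ≤ κ) {U : Submodule (ZMod 2) (Fin κ → ZMod 2)}
    (hU : Module.finrank (ZMod 2) U = κ - 1) (v : Fin κ → ZMod 2) :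
    qcheck κ U v = if v ∉ U then 1 / (2 : ℝ) ^ (κ - 1) else 0 := by
  have h : (2 : ℝ) ^ κ - 2 ^ (κ - 1) = 2 ^ (κ - 1) := by
    obtain ⟨k, rfl⟩ := Nat.exists_eq_add_of_le' hκ
    rw [Nat.add_sub_cancel, pow_succ]
    ring
  rw [qcheck, hU, h, ite_not]

lemma sum_qcheck {κ : ℕ} (hκ : 1 ≤ κ) {U : Submodule (ZMod 2) (Fin κ → ZMod 2)}
    (hU : Module.finrank (ZMod 2) U = κ - 1) : ∑ v, qcheck κ U v = 1 := by
  have hc := card_offVectors hκ hU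
  rw [offVectors] at hc
  simp only [qcheck_apply hκ hU]
  rw [← Finset.sum_filter, Finset.sum_const, hc, nsmul_eq_mul]
  push_cast
  exact mul_one_div_cancel (by positivity)

lemma one_sub_zeta_qcheck {κ : ℕ} (hκ : 1 ≤ κ) {U : Submodule (ZMod 2) (Fin κ → ZMod 2)}
    (hU : Module.finrank (ZMod 2) U = κ - 1) (S : Submodule (ZMod 2) (Fin κ → ZMod 2)) :
    1 - zeta κ S (qcheck κ U)
      = ((offVectors U).filter (fun v => v ∉ S)).card / (2 : ℝ) ^ (κ - 1) := by
  rw [← sum_qcheck hκ hU, zeta, ← Finset.sum_sub_distrib, offVectors, Finset.filter_filter]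
  simp only [qcheck_apply hκ hU]
  rw [Finset.sum_congr rfl (g := fun v => if v ∉ U ∧ v ∉ S then 1 / (2 : ℝ) ^ (κ - 1) else 0)
    fun v _ => by by_cases h1 : v ∈ U <;> by_cases h2 : v ∈ S <;> simp [h1, h2],
    ← Finset.sum_filter, Finset.sum_const, nsmul_eq_mul, mul_one_div]

/-- On the constraint sphere the mass moved into `U` is proportional to the squared displacement. -/
lemma zeta_sub_qcheck {κ : ℕ} (hκ : 1 ≤ κ) {U : Submodule (ZMod 2) (Fin κ → ZMod 2)}
    (hU : Module.finrank (ZMod 2) U = κ - 1) {q : (Fin κ → ZMod 2) → ℝ} (hq : ∑ v, q v = 1)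
    (hq0 : q 0 = 0) (hr : ∑ v, (q v - qbar κ v) ^ 2
      = ((2 : ℝ) ^ (κ - 1) - 1) / ((2 : ℝ) ^ (κ - 1) * ((2 : ℝ) ^ κ - 1))) :
    zeta κ U (fun v => q v - qcheck κ U v)
      = (2 : ℝ) ^ (κ - 1) / 2 * ∑ v, (q v - qcheck κ U v) ^ 2 := by
  have hpow : (2 : ℝ) ^ κ = 2 * 2 ^ (κ - 1) := by rw [← pow_succ', Nat.sub_add_cancel hκ]
  have hN1 : (1 : ℝ) ≤ 2 ^ (κ - 1) := one_le_pow₀ (by norm_num)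
  have hcardV : (Fintype.card (Fin κ → ZMod 2) : ℝ) = 2 ^ κ := by
    rw [Fintype.card_fun, ZMod.card, Fintype.card_fin]
    norm_num
  rw [hpow] at hr hcardV
  have hbar : ∀ v, (q v - qbar κ v) ^ 2 = q v ^ 2 - 2 * (1 / ((2 : ℝ) ^ κ - 1)) * q v
      + ((1 / ((2 : ℝ) ^ κ - 1)) ^ 2 - if v = 0 then (1 / ((2 : ℝ) ^ κ - 1)) ^ 2 else 0) := by
    intro v
    rw [qbar]
    split_ifs with h
    · rw [h, hq0]; ring
    · ring
  have hcheck : ∀ v, (q v - qcheck κ U v) ^ 2 = q v ^ 2 - 2 / (2 : ℝ) ^ (κ - 1) *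
      (q v - if v ∈ U then q v else 0) + 1 / (2 : ℝ) ^ (κ - 1) * qcheck κ U v := by
    intro v
    rw [qcheck_apply hκ hU]
    by_cases h : v ∈ U
    · simp [h]
    · simp only [h, not_false_iff, if_true, if_false]; ring
  have hz : zeta κ U (fun v => q v - qcheck κ U v) = zeta κ U q := by
    refine Finset.sum_congr rfl fun v _ => ?_
    split_ifs with h
    · simp [qcheck, h]
    · rfl
  simp only [hbar, Finset.sum_add_distrib, Finset.sum_sub_distrib, ← Finset.mul_sum, hq,
    Finset.sum_ite_eq', Finset.mem_univ, if_true, Finset.sum_const, nsmul_eq_mul,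
    Finset.card_univ, hcardV] at hr
  simp only [hcheck, Finset.sum_add_distrib, Finset.sum_sub_distrib, ← Finset.mul_sum, hq,
    sum_qcheck hκ hU]
  rw [hz, ← zeta]
  rw [hpow] at hr
  set N : ℝ := 2 ^ (κ - 1)
  have hsq : ∑ v, q v ^ 2 = 1 / N := by
    have h1 : (2 * N - 1) ≠ 0 := by linarith
    have h2 : N ≠ 0 := by linarith
    field_simp at hr ⊢
    have h3 : (2 * N - 1) * (N * ∑ v, q v ^ 2) = (2 * N - 1) * 1 := by linarith
    have := mul_left_cancel₀ h1 h3
    linarith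
  have h2 : N ≠ 0 := by linarith
  rw [hsq]
  field_simp
  ring

/-- Theorem 4: the first subspace exclusion code is a local minimizer of the expected
equivocation loss subject to nonnegativity, unit sum, exclusion of the zero column,
and the fixed-radius constraint. -/
theorem first_SEC_local_opt (κ n : ℕ) (hκ : 2 ≤ κ) (hn : 1 ≤ n)
    (ε : ℝ) (hε0 : 0 < ε) (hε1 : ε < 1)
    (U : Submodule (ZMod 2) (Fin κ → ZMod 2))
    (hU : Module.finrank (ZMod 2) U = κ - 1) :
    IsLocalMinOn (eqLoss κ n ε)
      {q ∈ simplex κ | q 0 = 0 ∧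
        ∑ v, (q v - qbar κ v) ^ 2
          = ((2 : ℝ) ^ (κ - 1) - 1) / ((2 : ℝ) ^ (κ - 1) * ((2 : ℝ) ^ κ - 1))}
      (qcheck κ U) := by
  have hκ1 : 1 ≤ κ := by omega
  have hidx := exists_index_two hκ1 hU
  have hcard := card_offVectors hκ1 hU
  set N : ℝ := 2 ^ (κ - 1) with hN
  have hN0 : 0 < N := by positivity
  have hcardV : (Fintype.card (Fin κ → ZMod 2) : ℝ) = 2 * N := by
    rw [Fintype.card_fun, ZMod.card, Fintype.card_fin, hN, ← pow_succ', Nat.sub_add_cancel hκ1]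
    norm_num
  obtain ⟨v, hv, w, hw, hvw⟩ : ∃ v ∈ offVectors U, ∃ w ∈ offVectors U, v ≠ w := by
    refine Finset.one_lt_card.1 ?_
    rw [hcard]
    exact Nat.one_lt_two_pow (by omega)
  rw [mem_offVectors] at hv hw
  have hw0 : w ≠ 0 := fun h => hw (h ▸ U.zero_mem)
  set a : ℝ := -(n * Real.log ε) with ha
  have ha0 : 0 < a := by
    have h1 : (0 : ℝ) < n := Nat.cast_pos.2 hn
    have := mul_pos h1 (neg_pos.2 (Real.log_neg hε0 hε1))
    linarith
  set x : ℝ := Real.exp (-(a / N)) with hx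
  have haN : 0 < a / N := div_pos ha0 hN0
  have hx0 : 0 < x := Real.exp_pos _
  have hx1 : x ≤ 1 := Real.exp_le_one_iff.2 (by linarith)
  have hlt := weightThroughPair_lt U hx0 hx1 hw0 hvw
  have hle := mul_weight_sub_le hx0.le hx1 hidx hv hw hvw
  have hcoef : 0 < a * (weightThrough U x (v + w) - weightThrough U x v) * (N / 2)
      + a ^ 2 / 2 * (weightThrough U x v - weightThroughPair U x v w) := by
    have hexp := Real.add_one_lt_exp (x := -(a / N)) (by linarith)
    have h1 := mul_lt_mul_of_pos_right hexp (sub_pos.2 hlt)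
    have h2 : 0 < (weightThrough U x (v + w) - weightThrough U x v)
        + a / N * (weightThrough U x v - weightThroughPair U x v w) := by
      rw [← hx] at h1
      linarith
    have h3 := mul_pos (mul_pos ha0 (half_pos hN0)) h2
    have h4 : a * (N / 2) * ((weightThrough U x (v + w) - weightThrough U x v)
        + a / N * (weightThrough U x v - weightThroughPair U x v w))
        = a * (weightThrough U x (v + w) - weightThrough U x v) * (N / 2)
          + a ^ 2 / 2 * (weightThrough U x v - weightThroughPair U x v w) := by
      field_simp
    linarith
  have hlim : ∀ c : ℝ, Filter.Tendsto
      (fun q : (Fin κ → ZMod 2) → ℝ => c * ∑ b, |q b - qcheck κ U b|)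
      (nhds (qcheck κ U)) (nhds 0) := fun c => by
    have hcont : Continuous
        (fun q : (Fin κ → ZMod 2) → ℝ => c * ∑ b, |q b - qcheck κ U b|) := by
      fun_prop
    simpa using hcont.tendsto (qcheck κ U)
  have hsmall := nhdsWithin_le_nhds (s := {q ∈ simplex κ | q 0 = 0 ∧
    ∑ v, (q v - qbar κ v) ^ 2 = (N - 1) / (N * ((2 : ℝ) ^ κ - 1))})
    ((hlim a).eventually_lt_const one_pos)
  have hsmall' := nhdsWithin_le_nhds (s := {q ∈ simplex κ | q 0 = 0 ∧
    ∑ v, (q v - qbar κ v) ^ 2 = (N - 1) / (N * ((2 : ℝ) ^ κ - 1))})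
    ((hlim (a ^ 2 / 2 * (|weightThroughPair U x v w| * (N / 2)
        + (weightThrough U x v - weightThroughPair U x v w) * (N / 2)
        + (∑ S, |lossWeight U x S|) * N)
        + (∑ S, |lossWeight U x S|) * a ^ 3 * (2 * N))).eventually_lt_const hcoef)
  filter_upwards [hsmall, hsmall', self_mem_nhdsWithin] with q hq1 hq2 hq
  obtain ⟨⟨hqnn, hqsum⟩, hq0, hqr⟩ := hq
  rw [eqLoss_eq_sum hε0, eqLoss_eq_sum hε0, add_le_add_iff_left, ← sub_nonneg,
    ← Finset.sum_sub_distrib]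
  have hnonneg := sum_lossWeight_mul_exp_nonneg ha0 hN0 hcardV hidx hv hw hvw hlt.le
    (d := fun b => q b - qcheck κ U b)
    (by rw [hq0, qcheck, if_pos U.zero_mem, sub_zero])
    (fun b hb => by rw [qcheck, if_pos hb, sub_zero]; exact hqnn b)
    (by rw [Finset.sum_sub_distrib, hqsum, sum_qcheck hκ1 hU, sub_self])
    (zeta_sub_qcheck hκ1 hU hqsum hq0 hqr) hq1.le hq2.le
  refine hnonneg.trans_eq (Finset.sum_congr rfl fun S _ => ?_)
  rw [lossWeight, mul_assoc, ← mul_sub, mul_sub, mul_one, zeta_sub, hx, ← Real.exp_nat_mul,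
    ← Real.exp_add]
  have hk := one_sub_zeta_qcheck hκ1 hU S
  rw [← hN] at hk
  have hk' : (((offVectors U).filter (fun v => v ∉ S)).card : ℝ) * -(a / N)
      = -a * (1 - zeta κ S (qcheck κ U)) := by
    rw [hk]; ring
  rw [hk', ha]
  congr 3 <;> ring
end

section
/- All-zero column exclusion for χ² divergence (Theorem 6): if q ∈ Δ is a local minimizer of the function q ↦ λ(q) relative to the set Δ (i.e., IsLocalMinOn λ Δ q), then q(0) = 0, where 0 denotes the zero vector of W. -/
attribute [local instance] Classical.propDecidable

/-- The χ² divergence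
`λ(q) = (2−ε)^n · 2^{−κ} · (1 + Σ_{dim S = κ−1} (ε/(2−ε))^{n(1−ζ(S,q))}) − 1`,
where the power with real exponent is the real power. -/
noncomputable def chiSq (κ n : ℕ) (ε : ℝ) (q : (Fin κ → ZMod 2) → ℝ) : ℝ :=
  (2 - ε) ^ n * (2 : ℝ) ^ (-(κ : ℤ)) *
      (1 + ∑ S ∈ Finset.univ.filter
            (fun S : Submodule (ZMod 2) (Fin κ → ZMod 2) =>
              Module.finrank (ZMod 2) S = κ - 1),
          (ε / (2 - ε)) ^ ((n : ℝ) * (1 - zeta κ S q))) - 1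

/-- `massShift v t q` moves mass `t` from the zero column to the column `v`. -/
noncomputable def massShift {κ : ℕ} (v : Fin κ → ZMod 2) (t : ℝ)
    (q : (Fin κ → ZMod 2) → ℝ) : (Fin κ → ZMod 2) → ℝ :=
  fun w => q w + t * ((if w = v then 1 else 0) - (if w = 0 then 1 else 0))

theorem zeta_massShift {κ : ℕ} (S : Submodule (ZMod 2) (Fin κ → ZMod 2))
    (v : Fin κ → ZMod 2) (t : ℝ) (q : (Fin κ → ZMod 2) → ℝ) :
    zeta κ S (massShift v t q) = zeta κ S q + t * ((if v ∈ S then 1 else 0) - 1) := by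
  have h : ∀ u : Fin κ → ZMod 2,
      ∑ w, (if w ∈ S then (if w = u then (1 : ℝ) else 0) else 0) = if u ∈ S then 1 else 0 := by
    intro u
    rw [Finset.sum_eq_single u]
    · simp
    · intro w _ hw
      simp [hw]
    · simp
  have h0 := h 0
  rw [if_pos S.zero_mem] at h0
  simp only [zeta, massShift]
  conv_rhs => rw [← h v]; enter [2, 2, 2]; rw [← h0]
  rw [← Finset.sum_sub_distrib, Finset.mul_sum, ← Finset.sum_add_distrib]
  refine Finset.sum_congr rfl fun w _ => ?_
  by_cases hw : w ∈ S <;> simp [hw]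

theorem massShift_mem_simplex {κ : ℕ} {v : Fin κ → ZMod 2} {t : ℝ}
    {q : (Fin κ → ZMod 2) → ℝ} (hq : q ∈ simplex κ) (ht : 0 ≤ t) (htq : t ≤ q 0) :
    massShift v t q ∈ simplex κ := by
  refine ⟨fun w => ?_, ?_⟩
  · have := hq.1 w
    unfold massShift
    by_cases hw : w = 0
    · subst hw
      split_ifs <;> linarith
    · rw [if_neg hw]
      split_ifs <;> linarith
  · have h := zeta_massShift ⊤ v t q
    simpa [zeta, hq.2] using h

theorem continuous_massShift {κ : ℕ} (v : Fin κ → ZMod 2) (q : (Fin κ → ZMod 2) → ℝ) :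
    Continuous fun t => massShift v t q := by
  unfold massShift
  fun_prop

theorem exists_hyperplane_notMem {κ : ℕ} (hκ : 1 ≤ κ) :
    ∃ (S : Submodule (ZMod 2) (Fin κ → ZMod 2)) (v : Fin κ → ZMod 2),
      Module.finrank (ZMod 2) S = κ - 1 ∧ v ∉ S := by
  let f : (Fin κ → ZMod 2) →ₗ[ZMod 2] ZMod 2 := LinearMap.proj ⟨0, hκ⟩
  have hf : Function.Surjective f := fun a => ⟨fun _ => a, rfl⟩
  refine ⟨LinearMap.ker f, fun _ => 1, ?_, ?_⟩
  · have h := f.finrank_range_add_finrank_ker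
    rw [LinearMap.range_eq_top.2 hf, finrank_top, Module.finrank_self,
      Module.finrank_fin_fun] at h
    omega
  · rw [LinearMap.mem_ker]
    exact one_ne_zero

theorem chiSq_massShift_lt {κ n : ℕ} (hn : 1 ≤ n) {ε : ℝ} (hε0 : 0 < ε) (hε1 : ε < 1)
    {S : Submodule (ZMod 2) (Fin κ → ZMod 2)} (hS : Module.finrank (ZMod 2) S = κ - 1)
    {v : Fin κ → ZMod 2} (hv : v ∉ S) {t : ℝ} (ht : 0 < t) (q : (Fin κ → ZMod 2) → ℝ) :
    chiSq κ n ε (massShift v t q) < chiSq κ n ε q := by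
  have hb0 : 0 < ε / (2 - ε) := div_pos hε0 (by linarith)
  have hb1 : ε / (2 - ε) < 1 := (div_lt_one (by linarith)).2 (by linarith)
  have hn' : (0 : ℝ) < n := by exact_mod_cast hn
  have hc : 0 < (2 - ε) ^ n * (2 : ℝ) ^ (-(κ : ℤ)) :=
    mul_pos (pow_pos (by linarith) _) (by positivity)
  unfold chiSq
  refine sub_lt_sub_right (mul_lt_mul_of_pos_left (add_lt_add_right ?_ _) hc) _
  refine Finset.sum_lt_sum (fun T _ => ?_) ⟨S, by simpa using hS, ?_⟩
  · refine Real.rpow_le_rpow_of_exponent_ge hb0 hb1.le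
      (mul_le_mul_of_nonneg_left ?_ hn'.le)
    rw [zeta_massShift]
    split_ifs <;> linarith
  · refine Real.rpow_lt_rpow_of_exponent_gt hb0 hb1 (mul_lt_mul_of_pos_left ?_ hn')
    rw [zeta_massShift, if_neg hv]
    linarith

/-- Theorem 6: a local minimizer of the χ² divergence on the simplex assigns
zero weight to the all-zero column. -/
theorem zero_column_exclusion_chiSq (κ n : ℕ) (hκ : 1 ≤ κ) (hn : 1 ≤ n)
    (ε : ℝ) (hε0 : 0 < ε) (hε1 : ε < 1)
    (q : (Fin κ → ZMod 2) → ℝ) (hq : q ∈ simplex κ)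
    (hmin : IsLocalMinOn (chiSq κ n ε) (simplex κ) q) :
    q 0 = 0 := by
  by_contra h0
  have hpos : 0 < q 0 := lt_of_le_of_ne (hq.1 0) (Ne.symm h0)
  obtain ⟨S, v, hS, hv⟩ := exists_hyperplane_notMem hκ
  have hIoc : ∀ᶠ t in nhdsWithin (0 : ℝ) (Set.Ioi 0), t ∈ Set.Ioc 0 (q 0) :=
    Ioc_mem_nhdsGT hpos
  have hlim : Filter.Tendsto (fun t => massShift v t q) (nhdsWithin 0 (Set.Ioi 0))
      (nhdsWithin q (simplex κ)) := by
    refine tendsto_nhdsWithin_iff.2 ⟨?_, hIoc.mono fun t ht =>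
      massShift_mem_simplex hq ht.1.le ht.2⟩
    have h := (continuous_massShift v q).tendsto 0
    rw [show massShift v 0 q = q by ext; simp [massShift]] at h
    exact h.mono_left nhdsWithin_le_nhds
  obtain ⟨t, hle, ht⟩ := ((hlim.eventually hmin).and hIoc).exists
  exact (chiSq_massShift_lt hn hε0 hε1 hS hv ht.1 q).not_ge hle
end

section
/- Global optimality of the uniform vector fraction code for χ² divergence (Theorem 7): for every q ∈ Δ, λ(q̄) ≤ λ(q), where q̄ is defined by q̄(0) = 0 and q̄(v) = 1/(2^κ − 1) for all v ≠ 0. -/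
attribute [local instance] Classical.propDecidable

theorem exists_linearEquiv_apply_eq_of_ne_zero {K V : Type*} [Field K] [AddCommGroup V]
    [Module K V] {x y : V} (hx : x ≠ 0) (hy : y ≠ 0) : ∃ g : V ≃ₗ[K] V, g x = y := by
  let f : Submodule.span K {x} ≃ₗ[K] Submodule.span K {y} :=
    (LinearEquiv.toSpanNonzeroSingleton K V x hx).symm ≪≫ₗ
      LinearEquiv.toSpanNonzeroSingleton K V y hy
  obtain ⟨g, hg⟩ := Submodule.exists_linearEquiv_restrict_eq f
  refine ⟨g, ?_⟩
  have h1 : LinearEquiv.toSpanNonzeroSingleton K V x hx 1 =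
      ⟨x, Submodule.mem_span_singleton_self x⟩ := LinearEquiv.toSpanNonzeroSingleton_one K V x hx
  have h2 := hg ⟨x, Submodule.mem_span_singleton_self x⟩
  rw [← h2]
  simp only [f, LinearEquiv.trans_apply, ← h1, LinearEquiv.symm_apply_apply]
  simp

/-- The number of subspaces of dimension `d` containing `v`. -/
noncomputable def numSubspacesContaining (κ d : ℕ) (v : Fin κ → ZMod 2) : ℕ :=
  (Finset.univ.filter fun S : Submodule (ZMod 2) (Fin κ → ZMod 2) =>
    Module.finrank (ZMod 2) S = d ∧ v ∈ S).card

theorem numSubspacesContaining_eq {κ : ℕ} (d : ℕ) {v w : Fin κ → ZMod 2} (hv : v ≠ 0)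
    (hw : w ≠ 0) : numSubspacesContaining κ d v = numSubspacesContaining κ d w := by
  obtain ⟨g, rfl⟩ := exists_linearEquiv_apply_eq_of_ne_zero (K := ZMod 2) hv hw
  refine Finset.card_equiv (Submodule.orderIsoMapComap g).toEquiv fun S => ?_
  simp [LinearEquiv.finrank_map_eq]

theorem numSubspacesContaining_le_zero {κ : ℕ} (d : ℕ) (v : Fin κ → ZMod 2) :
    numSubspacesContaining κ d v ≤ numSubspacesContaining κ d 0 := by
  refine Finset.card_le_card fun S hS => ?_
  simp only [Finset.mem_filter, Finset.mem_univ, true_and] at hS ⊢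
  exact ⟨hS.1, S.zero_mem⟩

theorem sum_zeta_eq (κ d : ℕ) (q : (Fin κ → ZMod 2) → ℝ) :
    ∑ S ∈ Finset.univ.filter (fun S : Submodule (ZMod 2) (Fin κ → ZMod 2) =>
        Module.finrank (ZMod 2) S = d), zeta κ S q =
      ∑ v, (numSubspacesContaining κ d v : ℝ) * q v := by
  unfold zeta numSubspacesContaining
  rw [Finset.sum_comm]
  refine Finset.sum_congr rfl fun v _ => ?_
  rw [← Finset.sum_filter, Finset.filter_filter, Finset.sum_const, nsmul_eq_mul]

theorem sum_ite_mem_eq_card_sub_one {κ : ℕ} (S : Submodule (ZMod 2) (Fin κ → ZMod 2)) :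
    ∑ v : Fin κ → ZMod 2, (if v ∈ S then (if v = 0 then (0 : ℝ) else 1) else 0) =
      (2 : ℝ) ^ Module.finrank (ZMod 2) S - 1 := by
  have hcard : ∑ v : Fin κ → ZMod 2, (if v ∈ S then (1 : ℝ) else 0) =
      (2 : ℝ) ^ Module.finrank (ZMod 2) S := by
    have h := Module.natCard_eq_pow_finrank (K := ZMod 2) (V := S)
    rw [Nat.card_zmod, Nat.card_eq_fintype_card, Fintype.card_subtype] at h
    rw [Finset.sum_boole, h]
    norm_cast
  have hzero : ∑ v : Fin κ → ZMod 2, (if v = 0 then (1 : ℝ) else 0) = 1 := by simp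
  rw [← hcard, ← hzero, ← Finset.sum_sub_distrib]
  refine Finset.sum_congr rfl fun v _ => ?_
  by_cases h0 : v = 0
  · simp [h0]
  · simp [h0]

theorem zeta_qbar {κ : ℕ} (S : Submodule (ZMod 2) (Fin κ → ZMod 2)) :
    zeta κ S (qbar κ) =
      ((2 : ℝ) ^ Module.finrank (ZMod 2) S - 1) / ((2 : ℝ) ^ κ - 1) := by
  rw [← sum_ite_mem_eq_card_sub_one, Finset.sum_div]
  refine Finset.sum_congr rfl fun v _ => ?_
  unfold qbar
  split_ifs <;> simp

theorem qbar_mem_simplex {κ : ℕ} (hκ : 1 ≤ κ) : qbar κ ∈ simplex κ := by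
  have h2 : (0 : ℝ) < 2 ^ κ - 1 := sub_pos.2 (one_lt_pow₀ one_lt_two (by omega))
  refine ⟨fun v => ?_, ?_⟩
  · unfold qbar
    split_ifs
    · rfl
    · positivity
  · have h := zeta_qbar (κ := κ) ⊤
    simp only [zeta, Submodule.mem_top, if_true, finrank_top, Module.finrank_fin_fun] at h
    rw [h, div_self h2.ne']

theorem sum_zeta_qbar_le {κ : ℕ} (hκ : 1 ≤ κ) (d : ℕ) {q : (Fin κ → ZMod 2) → ℝ}
    (hq : q ∈ simplex κ) :
    ∑ S ∈ Finset.univ.filter (fun S : Submodule (ZMod 2) (Fin κ → ZMod 2) =>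
        Module.finrank (ZMod 2) S = d), zeta κ S (qbar κ) ≤
      ∑ S ∈ Finset.univ.filter (fun S : Submodule (ZMod 2) (Fin κ → ZMod 2) =>
        Module.finrank (ZMod 2) S = d), zeta κ S q := by
  rw [sum_zeta_eq, sum_zeta_eq]
  obtain ⟨w, hw⟩ : ∃ w : Fin κ → ZMod 2, w ≠ 0 :=
    ⟨fun _ => 1, fun h => one_ne_zero (congrFun h ⟨0, hκ⟩)⟩
  calc ∑ v, (numSubspacesContaining κ d v : ℝ) * qbar κ v
      = ∑ v, (numSubspacesContaining κ d w : ℝ) * qbar κ v := by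
        refine Finset.sum_congr rfl fun v _ => ?_
        by_cases h0 : v = 0
        · simp [h0, qbar]
        · rw [numSubspacesContaining_eq d h0 hw]
    _ = ∑ v, (numSubspacesContaining κ d w : ℝ) * q v := by
        rw [← Finset.mul_sum, ← Finset.mul_sum, (qbar_mem_simplex hκ).2, hq.2]
    _ ≤ ∑ v, (numSubspacesContaining κ d v : ℝ) * q v := by
        refine Finset.sum_le_sum fun v _ => mul_le_mul_of_nonneg_right ?_ (hq.1 v)
        by_cases h0 : v = 0
        · rw [h0]
          exact_mod_cast numSubspacesContaining_le_zero d w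
        · rw [numSubspacesContaining_eq d h0 hw]

theorem rpow_tangent_le {a : ℝ} (ha : 0 < a) (x y : ℝ) :
    a ^ x + a ^ x * Real.log a * (y - x) ≤ a ^ y := by
  have h := mul_le_mul_of_nonneg_left (Real.add_one_le_exp (Real.log a * (y - x)))
    (Real.rpow_pos_of_pos ha x).le
  rw [← Real.rpow_def_of_pos ha, ← Real.rpow_add ha, add_sub_cancel] at h
  linarith

/-- If `∑ y ≤ ∑ x` with `x` constant, then `∑ a ^ x ≤ ∑ a ^ y` for `0 < a ≤ 1`. -/
theorem sum_rpow_const_le_sum_rpow {ι : Type*} (s : Finset ι) {a : ℝ} (ha : 0 < a) (ha1 : a ≤ 1)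
    (x : ℝ) (y : ι → ℝ) (h : ∑ i ∈ s, y i ≤ ∑ _i ∈ s, x) :
    ∑ _i ∈ s, a ^ x ≤ ∑ i ∈ s, a ^ y i := by
  have h1 := Finset.sum_le_sum fun i (_ : i ∈ s) => rpow_tangent_le ha x (y i)
  rw [Finset.sum_add_distrib, ← Finset.mul_sum, Finset.sum_sub_distrib] at h1
  have h2 : a ^ x * Real.log a ≤ 0 :=
    mul_nonpos_of_nonneg_of_nonpos (Real.rpow_pos_of_pos ha x).le (Real.log_nonpos ha.le ha1)
  have h3 := mul_nonneg_of_nonpos_of_nonpos h2 (sub_nonpos.2 h)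
  linarith

/-- Theorem 7: the uniform vector fraction code globally minimizes the χ² divergence
over the simplex. -/
theorem uniform_vector_fraction_global_opt_chiSq (κ n : ℕ) (hκ : 1 ≤ κ) (hn : 1 ≤ n)
    (ε : ℝ) (hε0 : 0 < ε) (hε1 : ε < 1)
    (q : (Fin κ → ZMod 2) → ℝ) (hq : q ∈ simplex κ) :
    chiSq κ n ε (qbar κ) ≤ chiSq κ n ε q := by
  have h2 : 0 < 2 - ε := by linarith
  have ha : 0 < ε / (2 - ε) := div_pos hε0 h2
  have ha1 : ε / (2 - ε) ≤ 1 := (div_le_one h2).2 (by linarith)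
  unfold chiSq
  refine sub_le_sub_right (mul_le_mul_of_nonneg_left (add_le_add_right ?_ 1) (by positivity)) 1
  have hconst : ∀ S ∈ Finset.univ.filter (fun S : Submodule (ZMod 2) (Fin κ → ZMod 2) =>
      Module.finrank (ZMod 2) S = κ - 1), zeta κ S (qbar κ) =
        ((2 : ℝ) ^ (κ - 1) - 1) / ((2 : ℝ) ^ κ - 1) := fun S hS => by
    rw [zeta_qbar, (Finset.mem_filter.1 hS).2]
  have hsum := sum_zeta_qbar_le hκ (κ - 1) hq
  rw [Finset.sum_congr rfl hconst] at hsum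
  rw [Finset.sum_congr rfl fun S hS => by rw [hconst S hS]]
  refine sum_rpow_const_le_sum_rpow _ ha ha1 _ _ ?_
  rw [← Finset.mul_sum, ← Finset.mul_sum, Finset.sum_sub_distrib, Finset.sum_sub_distrib]
  exact mul_le_mul_of_nonneg_left (sub_le_sub_left hsum _) n.cast_nonneg
end

section
/- Global optimality of the first subspace exclusion code for χ² divergence (Theorem 8): assume κ ≥ 2 and let U be any (κ−1)-dimensional subspace of W. Then for every q ∈ Δ with q(0) = 0 and Σ_{v∈W} (q(v) − q̄(v))² = (2^{κ−1} − 1)/(2^{κ−1}(2^κ − 1)), one has λ(q̌^{[U]}) ≤ λ(q). -/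
attribute [local instance] Classical.propDecidable

/-- The nontrivial additive character of `ZMod 2` with real values. -/
noncomputable def signChar (x : ZMod 2) : ℝ := if x = 0 then 1 else -1

lemma signChar_zero : signChar 0 = 1 := by simp [signChar]

lemma ZMod.two_eq_zero_or_eq_one (x : ZMod 2) : x = 0 ∨ x = 1 := by
  fin_cases x
  · exact Or.inl rfl
  · exact Or.inr rfl

lemma signChar_add (x y : ZMod 2) : signChar (x + y) = signChar x * signChar y := by
  have h : (1 + 1 : ZMod 2) = 0 := rfl
  rcases ZMod.two_eq_zero_or_eq_one x with rfl | rfl <;>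
    rcases ZMod.two_eq_zero_or_eq_one y with rfl | rfl <;> simp [signChar, h]

noncomputable instance {κ : ℕ} : Fintype (Module.Dual (ZMod 2) (Fin κ → ZMod 2)) :=
  haveI : Finite (Module.Dual (ZMod 2) (Fin κ → ZMod 2)) :=
    Finite.of_injective (fun f => (f : (Fin κ → ZMod 2) → ZMod 2)) DFunLike.coe_injective
  Fintype.ofFinite _

lemma card_dual (κ : ℕ) : Fintype.card (Module.Dual (ZMod 2) (Fin κ → ZMod 2)) = 2 ^ κ := by
  rw [Module.card_eq_pow_finrank (K := ZMod 2), Subspace.dual_finrank_eq]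
  simp

/-- Orthogonality of the characters of `(ZMod 2)^κ`. -/
lemma sum_dual_signChar {κ : ℕ} (v : Fin κ → ZMod 2) :
    ∑ f : Module.Dual (ZMod 2) (Fin κ → ZMod 2), signChar (f v)
      = if v = 0 then (2 : ℝ) ^ κ else 0 := by
  split_ifs with hv
  · subst hv
    simp [signChar_zero, card_dual]
  · obtain ⟨g, hg⟩ : ∃ g : Module.Dual (ZMod 2) (Fin κ → ZMod 2), g v ≠ 0 := by
      by_contra! h
      exact hv ((Module.forall_dual_apply_eq_zero_iff (ZMod 2) v).1 h)
    have h := Equiv.sum_comp (Equiv.addRight g)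
      (fun f : Module.Dual (ZMod 2) (Fin κ → ZMod 2) => signChar (f v))
    have hs : signChar (g v) = -1 := if_neg hg
    simp only [Equiv.coe_addRight, LinearMap.add_apply, signChar_add, hs,
      ← Finset.sum_mul] at h
    linarith

/-- Hyperplanes of `(ZMod 2)^κ` correspond to nonzero functionals. -/
lemma sum_hyperplane_eq_sum_dual {κ : ℕ} (hκ : 1 ≤ κ)
    (F : Submodule (ZMod 2) (Fin κ → ZMod 2) → ℝ) :
    ∑ S ∈ Finset.univ.filter (fun S : Submodule (ZMod 2) (Fin κ → ZMod 2) =>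
        Module.finrank (ZMod 2) S = κ - 1), F S
      = ∑ f ∈ (Finset.univ : Finset (Module.Dual (ZMod 2) (Fin κ → ZMod 2))).erase 0,
          F (LinearMap.ker f) := by
  have hfr : ∀ f : Module.Dual (ZMod 2) (Fin κ → ZMod 2), f ≠ 0 →
      Module.finrank (ZMod 2) (LinearMap.ker f) = κ - 1 := by
    intro f hf
    have := Module.Dual.finrank_ker_add_one_of_ne_zero hf
    rw [Module.finrank_fin_fun] at this
    omega
  symm
  refine Finset.sum_bij (fun f _ => LinearMap.ker f) ?_ ?_ ?_ (fun _ _ => rfl)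
  · intro f hf
    simpa using hfr f (Finset.ne_of_mem_erase hf)
  · intro f _ g _ h
    refine LinearMap.ext fun v => ?_
    have hv : f v = 0 ↔ g v = 0 := by rw [← LinearMap.mem_ker, ← LinearMap.mem_ker, h]
    rcases ZMod.two_eq_zero_or_eq_one (f v) with h1 | h1 <;>
    rcases ZMod.two_eq_zero_or_eq_one (g v) with h2 | h2 <;> simp_all
  · intro S hS
    replace hS : Module.finrank (ZMod 2) S = κ - 1 := by simpa using hS
    have hlt : S < ⊤ := by
      rw [lt_top_iff_ne_top]
      rintro rfl
      rw [finrank_top, Module.finrank_fin_fun] at hS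
      omega
    obtain ⟨f, hf, hSf⟩ := Submodule.exists_le_ker_of_lt_top S hlt
    exact ⟨f, by simpa using hf,
      (Submodule.eq_of_le_of_finrank_eq hSf (by rw [hS, hfr f hf])).symm⟩

lemma two_mul_zeta_ker_sub_one {κ : ℕ} (q : (Fin κ → ZMod 2) → ℝ) (hsum : ∑ v, q v = 1)
    (f : Module.Dual (ZMod 2) (Fin κ → ZMod 2)) :
    2 * zeta κ (LinearMap.ker f) q - 1 = ∑ v, q v * signChar (f v) := by
  rw [← hsum, zeta, Finset.mul_sum, ← Finset.sum_sub_distrib]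
  refine Finset.sum_congr rfl fun v _ => ?_
  by_cases h : f v = 0 <;> simp [signChar, h]
  ring

lemma sum_hyperplane_two_mul_zeta_sub_one {κ : ℕ} (hκ : 1 ≤ κ)
    (q : (Fin κ → ZMod 2) → ℝ) (hsum : ∑ v, q v = 1) (hq0 : q 0 = 0) :
    ∑ S ∈ Finset.univ.filter (fun S : Submodule (ZMod 2) (Fin κ → ZMod 2) =>
        Module.finrank (ZMod 2) S = κ - 1), (2 * zeta κ S q - 1) = -1 := by
  rw [sum_hyperplane_eq_sum_dual hκ fun S => 2 * zeta κ S q - 1,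
    Finset.sum_erase_eq_sub (Finset.mem_univ _)]
  simp only [two_mul_zeta_ker_sub_one q hsum]
  rw [Finset.sum_comm]
  simp only [← Finset.mul_sum, sum_dual_signChar]
  simp [hq0, signChar_zero, hsum]

/-- Parseval's identity, restricted to the nontrivial characters. -/
lemma sum_hyperplane_two_mul_zeta_sub_one_sq {κ : ℕ} (hκ : 1 ≤ κ)
    (q : (Fin κ → ZMod 2) → ℝ) (hsum : ∑ v, q v = 1) :
    ∑ S ∈ Finset.univ.filter (fun S : Submodule (ZMod 2) (Fin κ → ZMod 2) =>
        Module.finrank (ZMod 2) S = κ - 1), (2 * zeta κ S q - 1) ^ 2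
      = 2 ^ κ * ∑ v, q v ^ 2 - 1 := by
  rw [sum_hyperplane_eq_sum_dual hκ fun S => (2 * zeta κ S q - 1) ^ 2,
    Finset.sum_erase_eq_sub (Finset.mem_univ _)]
  simp only [two_mul_zeta_ker_sub_one q hsum]
  congr 1
  · have h1 : ∀ f : Module.Dual (ZMod 2) (Fin κ → ZMod 2),
        (∑ v, q v * signChar (f v)) ^ 2
          = ∑ v, ∑ w, q v * q w * signChar (f (v + w)) := by
      intro f
      rw [sq, Finset.sum_mul_sum]
      refine Finset.sum_congr rfl fun v _ => Finset.sum_congr rfl fun w _ => ?_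
      rw [map_add, signChar_add]
      ring
    simp only [h1]
    rw [Finset.sum_comm, Finset.mul_sum]
    refine Finset.sum_congr rfl fun v _ => ?_
    rw [Finset.sum_comm]
    simp only [← Finset.mul_sum, sum_dual_signChar]
    rw [Finset.sum_eq_single v]
    · have : v + v = 0 := funext fun i => CharTwo.add_self_eq_zero (v i)
      rw [if_pos this]
      ring
    · intro w _ hw
      rw [if_neg, mul_zero]
      intro h
      exact hw (funext fun i => (CharTwo.add_eq_zero.1 (congrFun h i)).symm)
    · simp
  · simp [signChar_zero, hsum]

/-- Monotonicity of `t ↦ (exp t - 1 - t) / t ^ 2`, in a form free of division. -/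
lemma sq_mul_exp_neg_le {c y : ℝ} (hc : 0 ≤ c) (hy : -1 ≤ y) :
    1 + c * y + (Real.exp (-c) - 1 + c) * y ^ 2 ≤ Real.exp (c * y) := by
  have hd1 : ∀ x : ℝ, HasDerivAt
      (fun x => y * (Real.exp (x * y) - 1) - y ^ 2 * (1 - Real.exp (-x)))
      (y ^ 2 * (Real.exp (x * y) - Real.exp (-x))) x := by
    intro x
    have h1 := ((hasDerivAt_id x).mul_const y).exp
    have h2 := (hasDerivAt_id x).neg.exp
    refine (((h1.sub_const 1).const_mul y).sub
      ((h2.const_sub 1).const_mul (y ^ 2))).congr_deriv ?_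
    simp only [id_eq, Pi.neg_apply]
    ring
  have hd0 : ∀ x : ℝ, HasDerivAt
      (fun x => Real.exp (x * y) - 1 - x * y - y ^ 2 * (Real.exp (-x) - 1 + x))
      (y * (Real.exp (x * y) - 1) - y ^ 2 * (1 - Real.exp (-x))) x := by
    intro x
    have h0 := (hasDerivAt_id x).mul_const y
    have h2 := (hasDerivAt_id x).neg.exp
    refine (((h0.exp.sub_const 1).sub h0).sub
      (((h2.sub_const 1).add (hasDerivAt_id x)).const_mul (y ^ 2))).congr_deriv ?_
    simp only [id_eq, Pi.neg_apply]
    ring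
  have m1 : MonotoneOn
      (fun x => y * (Real.exp (x * y) - 1) - y ^ 2 * (1 - Real.exp (-x))) (Set.Ici 0) := by
    refine monotoneOn_of_hasDerivWithinAt_nonneg (convex_Ici 0)
      (fun x _ => (hd1 x).continuousAt.continuousWithinAt)
      (fun x _ => (hd1 x).hasDerivWithinAt) fun x hx => ?_
    rw [interior_Ici, Set.mem_Ioi] at hx
    refine mul_nonneg (sq_nonneg y) (sub_nonneg.2 (Real.exp_le_exp.2 ?_))
    nlinarith
  have m0 : MonotoneOn
      (fun x => Real.exp (x * y) - 1 - x * y - y ^ 2 * (Real.exp (-x) - 1 + x))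
      (Set.Ici 0) := by
    refine monotoneOn_of_hasDerivWithinAt_nonneg (convex_Ici 0)
      (fun x _ => (hd0 x).continuousAt.continuousWithinAt)
      (fun x _ => (hd0 x).hasDerivWithinAt) fun x hx => ?_
    rw [interior_Ici, Set.mem_Ioi] at hx
    have := m1 (Set.mem_Ici.2 le_rfl) (Set.mem_Ici.2 hx.le) hx.le
    simpa using this
  have := m0 (Set.mem_Ici.2 le_rfl) (Set.mem_Ici.2 hc) hc
  simp at this
  linarith

/-- Among families with entries at least `-1`, sum `-1` and sum of squares `1`, the sum of
`exp (c * ·)` is smallest for a family having one entry equal to `-1`. -/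
lemma sum_exp_le_sum_exp {ι : Type*} (s : Finset ι) (z y : ι → ℝ) {c : ℝ} (hc : 0 ≤ c)
    {i : ι} (hi : i ∈ s) (hz : z i = -1) (hz2 : ∑ j ∈ s, z j ^ 2 = 1)
    (hy : ∀ j ∈ s, -1 ≤ y j) (hy1 : ∑ j ∈ s, y j = -1) (hy2 : ∑ j ∈ s, y j ^ 2 = 1) :
    ∑ j ∈ s, Real.exp (c * z j) ≤ ∑ j ∈ s, Real.exp (c * y j) := by
  have hz0 : ∀ j ∈ s.erase i, z j = 0 := by
    rw [← Finset.add_sum_erase s _ hi, hz] at hz2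
    have h0 : ∑ j ∈ s.erase i, z j ^ 2 = 0 := by linarith
    rw [Finset.sum_eq_zero_iff_of_nonneg fun j _ => sq_nonneg _] at h0
    exact fun j hj => pow_eq_zero_iff two_ne_zero |>.1 (h0 j hj)
  have hl : ∑ j ∈ s, Real.exp (c * z j) = (s.card : ℝ) + (Real.exp (-c) - 1) := by
    rw [← Finset.add_sum_erase s _ hi, hz,
      Finset.sum_congr rfl fun j hj => by rw [hz0 j hj, mul_zero, Real.exp_zero],
      ← Finset.card_erase_add_one hi]
    simp
    ring
  have hr : ∑ j ∈ s, (1 + c * y j + (Real.exp (-c) - 1 + c) * y j ^ 2)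
      = (s.card : ℝ) + (Real.exp (-c) - 1) := by
    simp only [Finset.sum_add_distrib, ← Finset.mul_sum, hy1, hy2]
    simp
    ring
  rw [hl, ← hr]
  exact Finset.sum_le_sum fun j hj => sq_mul_exp_neg_le hc (hy j hj)

lemma sum_sub_qbar_sq {κ : ℕ} (hκ : 1 ≤ κ) (q : (Fin κ → ZMod 2) → ℝ)
    (hsum : ∑ v, q v = 1) (hq0 : q 0 = 0) :
    ∑ v, (q v - qbar κ v) ^ 2 = ∑ v, q v ^ 2 - 1 / ((2 : ℝ) ^ κ - 1) := by
  have hN : (2 : ℝ) ^ κ - 1 ≠ 0 := by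
    have := one_lt_pow₀ (one_lt_two : (1 : ℝ) < 2) (by omega : κ ≠ 0)
    linarith
  have h : ∀ v, (q v - qbar κ v) ^ 2 = q v ^ 2 - 2 / ((2 : ℝ) ^ κ - 1) * q v
      + (1 / ((2 : ℝ) ^ κ - 1) ^ 2 - if v = 0 then 1 / ((2 : ℝ) ^ κ - 1) ^ 2 else 0) := by
    intro v
    by_cases hv : v = 0
    · subst hv
      simp [qbar, hq0]
    · simp only [qbar, hv, if_false]
      field_simp
      ring
  simp only [h, Finset.sum_add_distrib, Finset.sum_sub_distrib, ← Finset.mul_sum, hsum]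
  simp
  field_simp
  ring

lemma sum_qcheck_pow {κ : ℕ} (hκ : 1 ≤ κ) (U : Submodule (ZMod 2) (Fin κ → ZMod 2))
    (hU : Module.finrank (ZMod 2) U = κ - 1) {m : ℕ} (hm : m ≠ 0) :
    ∑ v, qcheck κ U v ^ m = 2 ^ (κ - 1) * (1 / (2 : ℝ) ^ (κ - 1)) ^ m := by
  have hpow : (2 : ℝ) ^ κ = 2 * 2 ^ (κ - 1) := by
    rw [← pow_succ', Nat.sub_add_cancel hκ]
  have hcard : ((Finset.univ.filter fun v => v ∈ U).card : ℝ) = 2 ^ (κ - 1) := by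
    have h := Module.card_eq_pow_finrank (K := ZMod 2) (V := U)
    rw [hU, ZMod.card, Fintype.card_subtype] at h
    exact_mod_cast h
  have h : ∀ v, qcheck κ U v ^ m
      = (1 / (2 : ℝ) ^ (κ - 1)) ^ m - if v ∈ U then (1 / (2 : ℝ) ^ (κ - 1)) ^ m else 0 := by
    intro v
    have h2 : (2 : ℝ) ^ κ - 2 ^ (κ - 1) = 2 ^ (κ - 1) := by rw [hpow]; ring
    rw [qcheck, hU, h2]
    split_ifs <;> simp [hm]
  simp only [h, Finset.sum_sub_distrib]
  rw [← Finset.sum_filter, Finset.sum_const, Finset.sum_const, nsmul_eq_mul, nsmul_eq_mul,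
    hcard, Finset.card_univ]
  simp only [Fintype.card_fun, ZMod.card, Fintype.card_fin, Nat.cast_pow, Nat.cast_ofNat, hpow]
  ring

/-- Theorem 8: the first subspace exclusion code globally minimizes the χ² divergence
subject to nonnegativity, unit sum, exclusion of the zero column, and the
fixed-radius constraint. -/
theorem first_SEC_global_opt_chiSq (κ n : ℕ) (hκ : 2 ≤ κ) (hn : 1 ≤ n)
    (ε : ℝ) (hε0 : 0 < ε) (hε1 : ε < 1)
    (U : Submodule (ZMod 2) (Fin κ → ZMod 2))
    (hU : Module.finrank (ZMod 2) U = κ - 1)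
    (q : (Fin κ → ZMod 2) → ℝ) (hq : q ∈ simplex κ) (hq0 : q 0 = 0)
    (hrad : ∑ v, (q v - qbar κ v) ^ 2
      = ((2 : ℝ) ^ (κ - 1) - 1) / ((2 : ℝ) ^ (κ - 1) * ((2 : ℝ) ^ κ - 1))) :
    chiSq κ n ε (qcheck κ U) ≤ chiSq κ n ε q := by
  obtain ⟨hqn, hsum⟩ := hq
  have hκ1 : 1 ≤ κ := by omega
  have hpow : (2 : ℝ) ^ κ = 2 * 2 ^ (κ - 1) := by
    rw [← pow_succ', Nat.sub_add_cancel hκ1]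
  have hM : (1 : ℝ) < 2 ^ (κ - 1) := one_lt_pow₀ one_lt_two (by omega)
  have hq2 : (2 : ℝ) ^ κ * ∑ v, q v ^ 2 - 1 = 1 := by
    rw [sum_sub_qbar_sq hκ1 q hsum hq0, hpow] at hrad
    have hN : (2 : ℝ) * 2 ^ (κ - 1) - 1 ≠ 0 := by linarith
    rw [sub_eq_iff_eq_add.1 hrad, hpow]
    field_simp
    ring
  have hcsum : ∑ v, qcheck κ U v = 1 := by
    have := sum_qcheck_pow hκ1 U hU one_ne_zero
    simp only [pow_one] at this
    rw [this]
    field_simp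
  have hc2 : (2 : ℝ) ^ κ * ∑ v, qcheck κ U v ^ 2 - 1 = 1 := by
    rw [sum_qcheck_pow hκ1 U hU two_ne_zero, hpow]
    field_simp
    ring
  have hzU : zeta κ U (qcheck κ U) = 0 :=
    Finset.sum_eq_zero fun v _ => by by_cases hv : v ∈ U <;> simp [qcheck, hv]
  have hr0 : 0 < ε / (2 - ε) := div_pos hε0 (by linarith)
  have hr1 : ε / (2 - ε) ≤ 1 := (div_le_one (by linarith)).2 (by linarith)
  have hlog : Real.log (ε / (2 - ε)) ≤ 0 := Real.log_nonpos hr0.le hr1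
  set c : ℝ := -(Real.log (ε / (2 - ε)) * n / 2) with hc_def
  have hc : 0 ≤ c := by
    have := mul_nonneg (neg_nonneg.2 hlog) (Nat.cast_nonneg (α := ℝ) n)
    rw [hc_def]
    linarith
  have hterm : ∀ x : ℝ, (ε / (2 - ε)) ^ ((n : ℝ) * (1 - x))
      = Real.exp (-c) * Real.exp (c * (2 * x - 1)) := by
    intro x
    rw [Real.rpow_def_of_pos hr0, ← Real.exp_add, hc_def]
    congr 1
    ring
  have key := sum_exp_le_sum_exp
    (Finset.univ.filter fun S : Submodule (ZMod 2) (Fin κ → ZMod 2) =>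
      Module.finrank (ZMod 2) S = κ - 1)
    (fun S => 2 * zeta κ S (qcheck κ U) - 1) (fun S => 2 * zeta κ S q - 1) hc
    (i := U) (by simpa using hU) (by simp [hzU])
    (by rw [sum_hyperplane_two_mul_zeta_sub_one_sq hκ1 _ hcsum, hc2])
    (fun S _ => by
      have : 0 ≤ zeta κ S q :=
        Finset.sum_nonneg fun v _ => by split_ifs <;> simp [hqn v]
      linarith)
    (sum_hyperplane_two_mul_zeta_sub_one hκ1 q hsum hq0)
    (by rw [sum_hyperplane_two_mul_zeta_sub_one_sq hκ1 _ hsum, hq2])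
  have h2 : (0 : ℝ) ≤ 2 - ε := by linarith
  unfold chiSq
  simp only [hterm, ← Finset.mul_sum]
  gcongr
end
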